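/- Let G = SL₂(ℝ), Γ = SL₂(ℤ), and let X = Γ\G be the space of right cosets Γg with the quotient topology and the right G-action (Γg)·h = Γ(gh). For t, s ∈ ℝ put a(t) = [[e^{−t/2}, 0],[0, e^{t/2}]] and u_s = [[1, s],[0,1]]. Let μ be a Borel probability measure on X invariant under the right G-action. Let (n_i) and (m_i) be sequences of positive integers with n_i → ∞ and m_i → ∞, and set T_i = ln(n_i·m_i) and Λ_{m_i} = {ℓ : 1 ≤ ℓ ≤ m_i, gcd(ℓ, m_i) = 1}. Then for every compactly supported continuous function f : X → ℝ, (1/(T_i·φ(m_i))) · Σ_{ℓ∈Λ_{m_i}} ∫₀^{T_i} f( Γ·(u_{ℓ/m_i}·a(t)·u_{n_i}) ) dt → ∫_X f dμ as i → ∞. -/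

import Mathlib

open MeasureTheory Filter Matrix

noncomputable section

/-- `G = SL₂(ℝ)`. -/
abbrev SL2R := Matrix.SpecialLinearGroup (Fin 2) ℝ

instance : TopologicalSpace SL2R :=
  TopologicalSpace.induced (fun g : SL2R => (g : Matrix (Fin 2) (Fin 2) ℝ)) inferInstance

/-- `Γ = SL₂(ℤ)`, viewed as a subgroup of `SL₂(ℝ)`. -/
def SL2Z : Subgroup SL2R :=
  (Matrix.SpecialLinearGroup.map (n := Fin 2) (Int.castRingHom ℝ)).range

/-- `X = Γ\G`, the space of right cosets `Γg`. -/
def XmodGamma := Quotient (QuotientGroup.rightRel SL2Z)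

instance : TopologicalSpace XmodGamma := instTopologicalSpaceQuotient
instance : MeasurableSpace XmodGamma := borel XmodGamma
instance : BorelSpace XmodGamma := ⟨rfl⟩

/-- The right `G`-action on `X = Γ\G`: `(Γg)·h = Γ(gh)`. -/
def rmul (h : SL2R) : XmodGamma → XmodGamma :=
  Quotient.map' (fun g => g * h) (by
    intro a b hab
    rw [QuotientGroup.rightRel_apply] at hab ⊢
    simpa [_root_.mul_inv_rev, mul_assoc] using hab)

/-- `u_s = [[1, s],[0,1]]` as an element of `SL₂(ℝ)`. -/
def uSL (s : ℝ) : SL2R :=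
  ⟨!![1, s; 0, 1], by simp [Matrix.det_fin_two_of]⟩

/-- `a(t) = [[e^{−t/2}, 0],[0, e^{t/2}]]` as an element of `SL₂(ℝ)`. -/
def aSL (t : ℝ) : SL2R :=
  ⟨!![Real.exp (-(t / 2)), 0; 0, Real.exp (t / 2)], by
    simp [Matrix.det_fin_two_of, ← Real.exp_add]⟩

instance instITG : IsTopologicalGroup SL2R :=
  (inferInstance : @IsTopologicalGroup (Matrix.SpecialLinearGroup (Fin 2) ℝ)
    Matrix.SpecialLinearGroup.instTopologicalSpace _)

/-- The projection `G → Γ\G`. -/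
def pj (g : SL2R) : XmodGamma := (Quotient.mk'' g : XmodGamma)

/-- The integral matrices inside `G`. -/
def zmat (γ : Matrix.SpecialLinearGroup (Fin 2) ℤ) : SL2R :=
  Matrix.SpecialLinearGroup.map (n := Fin 2) (Int.castRingHom ℝ) γ

lemma zmat_apply (γ : Matrix.SpecialLinearGroup (Fin 2) ℤ) (i j : Fin 2) :
    (zmat γ).1 i j = ((γ.1 i j : ℤ) : ℝ) := by
  simp [zmat]

lemma pj_eq_iff (g g' : SL2R) : pj g = pj g' ↔ ∃ γ, g' = zmat γ * g := by
  have h0 : pj g = pj g' ↔ g' * g⁻¹ ∈ SL2Z :=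
    (Quotient.eq'' (s₁ := QuotientGroup.rightRel SL2Z)).trans QuotientGroup.rightRel_apply
  rw [h0]
  unfold SL2Z
  rw [MonoidHom.mem_range]
  constructor
  · rintro ⟨γ, h⟩
    refine ⟨γ, ?_⟩
    rw [zmat, h]; simp
  · rintro ⟨γ, h⟩
    refine ⟨γ, ?_⟩
    rw [h, zmat]; simp

lemma pj_zmat_mul (γ) (g : SL2R) : pj (zmat γ * g) = pj g :=
  ((pj_eq_iff _ _).2 ⟨γ, rfl⟩).symm

lemma rmul_pj (h g : SL2R) : rmul h (pj g) = pj (g * h) := rfl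

lemma pj_surj : Function.Surjective pj := fun x => by
  induction x using Quotient.inductionOn' with
  | h g => exact ⟨g, rfl⟩

lemma pj_cont : Continuous pj := continuous_quot_mk

lemma pj_isOpenMap : IsOpenMap pj := by
  intro U hU
  have h1 : IsOpen (pj ⁻¹' (pj '' U)) := by
    have : pj ⁻¹' (pj '' U) = ⋃ γ, (fun g => zmat γ * g) ⁻¹' U := by
      ext g
      simp only [Set.mem_preimage, Set.mem_image, Set.mem_iUnion]
      constructor
      · rintro ⟨u, hu, h⟩
        obtain ⟨γ, hγ⟩ := (pj_eq_iff _ _).1 h.symm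
        exact ⟨γ, hγ ▸ hu⟩
      · rintro ⟨γ, h⟩
        exact ⟨_, h, pj_zmat_mul _ _⟩
    rw [this]
    exact isOpen_iUnion fun γ => hU.preimage (continuous_const_mul _)
  exact h1

lemma pj_openQuot : IsOpenQuotientMap pj := ⟨pj_surj, pj_cont, pj_isOpenMap⟩

lemma rmul_cont₂ : Continuous (fun p : XmodGamma × SL2R => rmul p.2 p.1) := by
  have h := pj_openQuot.prodMap (IsOpenQuotientMap.id (X := SL2R))
  refine h.isQuotientMap.continuous_iff.2 ?_
  exact pj_cont.comp (continuous_fst.mul continuous_snd)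

lemma rmul_cont (h : SL2R) : Continuous (rmul h) :=
  rmul_cont₂.comp (continuous_id.prodMk continuous_const)

lemma rmul_rmul (h k : SL2R) (x : XmodGamma) : rmul h (rmul k x) = rmul (k * h) x := by
  obtain ⟨g, rfl⟩ := pj_surj x
  simp [rmul_pj, mul_assoc]

lemma rmul_one (x : XmodGamma) : rmul 1 x = x := by
  obtain ⟨g, rfl⟩ := pj_surj x
  simp [rmul_pj]

lemma sl_cont_iff {Y : Type*} [TopologicalSpace Y] (φ : Y → SL2R) :
    Continuous φ ↔ ∀ i j, Continuous fun y => (φ y).1 i j := by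
  rw [continuous_induced_rng]
  constructor
  · intro h i j
    exact (continuous_apply_apply i j).comp h
  · intro h
    exact continuous_matrix h

lemma entry_cont (i j : Fin 2) : Continuous fun g : SL2R => g.1 i j :=
  (sl_cont_iff (fun g : SL2R => g)).1 continuous_id i j

/-- lower unipotent -/
def nSL (r : ℝ) : SL2R :=
  ⟨!![1, 0; r, 1], by simp [Matrix.det_fin_two_of]⟩

lemma uSL_cont : Continuous uSL := by
  rw [sl_cont_iff]
  intro i j
  fin_cases i <;> fin_cases j <;> simp [uSL] <;> fun_prop

lemma aSL_cont : Continuous aSL := by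
  rw [sl_cont_iff]
  intro i j
  fin_cases i <;> fin_cases j <;> simp [aSL] <;> fun_prop

lemma sl_ext {g h : SL2R} (h00 : g.1 0 0 = h.1 0 0) (h01 : g.1 0 1 = h.1 0 1)
    (h10 : g.1 1 0 = h.1 1 0) (h11 : g.1 1 1 = h.1 1 1) : g = h := by
  apply Subtype.ext
  ext i j
  fin_cases i <;> fin_cases j <;> simpa

lemma mul00 (g h : SL2R) : (g * h).1 0 0 = g.1 0 0 * h.1 0 0 + g.1 0 1 * h.1 1 0 := by
  simp [Matrix.mul_apply]
lemma mul01 (g h : SL2R) : (g * h).1 0 1 = g.1 0 0 * h.1 0 1 + g.1 0 1 * h.1 1 1 := by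
  simp [Matrix.mul_apply]
lemma mul10 (g h : SL2R) : (g * h).1 1 0 = g.1 1 0 * h.1 0 0 + g.1 1 1 * h.1 1 0 := by
  simp [Matrix.mul_apply]
lemma mul11 (g h : SL2R) : (g * h).1 1 1 = g.1 1 0 * h.1 0 1 + g.1 1 1 * h.1 1 1 := by
  simp [Matrix.mul_apply]
lemma det1 (g : SL2R) : g.1 0 0 * g.1 1 1 - g.1 0 1 * g.1 1 0 = 1 := by
  rw [← Matrix.det_fin_two]; exact g.2

@[simp] lemma uSL00 (s : ℝ) : (uSL s).1 0 0 = 1 := rfl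
@[simp] lemma uSL01 (s : ℝ) : (uSL s).1 0 1 = s := rfl
@[simp] lemma uSL10 (s : ℝ) : (uSL s).1 1 0 = 0 := rfl
@[simp] lemma uSL11 (s : ℝ) : (uSL s).1 1 1 = 1 := rfl
@[simp] lemma nSL00 (s : ℝ) : (nSL s).1 0 0 = 1 := rfl
@[simp] lemma nSL01 (s : ℝ) : (nSL s).1 0 1 = 0 := rfl
@[simp] lemma nSL10 (s : ℝ) : (nSL s).1 1 0 = s := rfl
@[simp] lemma nSL11 (s : ℝ) : (nSL s).1 1 1 = 1 := rfl
@[simp] lemma aSL00 (s : ℝ) : (aSL s).1 0 0 = Real.exp (-(s / 2)) := rfl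
@[simp] lemma aSL01 (s : ℝ) : (aSL s).1 0 1 = 0 := rfl
@[simp] lemma aSL10 (s : ℝ) : (aSL s).1 1 0 = 0 := rfl
@[simp] lemma aSL11 (s : ℝ) : (aSL s).1 1 1 = Real.exp (s / 2) := rfl
@[simp] lemma one00 : (1 : SL2R).1 0 0 = 1 := rfl
@[simp] lemma one01 : (1 : SL2R).1 0 1 = 0 := rfl
@[simp] lemma one10 : (1 : SL2R).1 1 0 = 0 := rfl
@[simp] lemma one11 : (1 : SL2R).1 1 1 = 1 := rfl

lemma uSL_add (s t : ℝ) : uSL (s + t) = uSL s * uSL t := by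
  apply sl_ext <;> simp only [mul00, mul01, mul10, mul11] <;> simp [add_comm]

lemma aSL_add (s t : ℝ) : aSL (s + t) = aSL s * aSL t := by
  apply sl_ext <;> simp only [mul00, mul01, mul10, mul11] <;> simp [← Real.exp_add] <;> ring

lemma uSL_aSL_uSL (x t s : ℝ) :
    uSL x * aSL t * uSL s = uSL (x + s * Real.exp (-t)) * aSL t := by
  apply sl_ext <;> simp only [mul00, mul01, mul10, mul11] <;> simp
  have : Real.exp (-t) * Real.exp (t/2) = Real.exp (-(t/2)) := by
    rw [← Real.exp_add]; congr 1; ring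
  linear_combination (-s) * this

/-- integral upper unipotent -/
def uZ (k : ℤ) : Matrix.SpecialLinearGroup (Fin 2) ℤ :=
  ⟨!![1, k; 0, 1], by simp [Matrix.det_fin_two_of]⟩

/-- integer translation -/
lemma pj_uSL_int (k : ℤ) (g : SL2R) : pj (uSL k * g) = pj g := by
  have : uSL k = zmat (uZ k) := by
    apply sl_ext <;> rw [zmat_apply] <;> simp [uZ]
  rw [this, pj_zmat_mul]

/-- entrywise closeness to the identity -/
def near1 (δ : ℝ) (h : SL2R) : Prop :=
  |h.1 0 0 - 1| < δ ∧ |h.1 0 1| < δ ∧ |h.1 1 0| < δ ∧ |h.1 1 1 - 1| < δ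

/-- uniform continuity under right translations -/
def RUC (f : XmodGamma → ℝ) : Prop :=
  ∀ ε > 0, ∃ δ > 0, ∀ h, near1 δ h → ∀ g, |f (pj (g * h)) - f (pj g)| ≤ ε

lemma near1_of_nhds {v : Set SL2R} (hv : v ∈ nhds (1 : SL2R)) :
    ∃ δ > 0, ∀ h, near1 δ h → h ∈ v := by
  rw [nhds_induced, mem_comap] at hv
  obtain ⟨w, hw, hwv⟩ := hv
  have hw' : w ∈ @nhds (Fin 2 → Fin 2 → ℝ) _ (((1 : SL2R)).1) := hw
  obtain ⟨δ, hδ, hb⟩ := (Metric.mem_nhds_iff (α := Fin 2 → Fin 2 → ℝ)).1 hw'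
  refine ⟨δ, hδ, fun h hh => hwv (hb ?_)⟩
  obtain ⟨h1, h2, h3, h4⟩ := hh
  show @dist (Fin 2 → Fin 2 → ℝ) _ (h.1) ((1 : SL2R).1) < δ
  refine (dist_pi_lt_iff hδ).2 fun i => (dist_pi_lt_iff hδ).2 fun j => ?_
  rw [Real.dist_eq]
  fin_cases i <;> fin_cases j
  · exact h1
  · have := h2; rw [← sub_zero (h.1 0 1)] at this; exact this
  · have := h3; rw [← sub_zero (h.1 1 0)] at this; exact this
  · exact h4

lemma near_compact : IsCompact {h : SL2R | ∀ i j, |h.1 i j| ≤ 2} := by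
  have hind : Topology.IsInducing (fun g : SL2R => (g : Matrix (Fin 2) (Fin 2) ℝ)) := ⟨rfl⟩
  rw [hind.isCompact_iff]
  have : (fun g : SL2R => (g : Matrix (Fin 2) (Fin 2) ℝ)) '' {h : SL2R | ∀ i j, |h.1 i j| ≤ 2}
      = {A : Matrix (Fin 2) (Fin 2) ℝ | ∀ i j, A i j ∈ Set.Icc (-2) 2} ∩ {A | A.det = 1} := by
    ext A
    simp only [Set.mem_image, Set.mem_ofPred_eq, Set.mem_inter_iff, Set.mem_Icc]
    constructor
    · rintro ⟨h, hh, rfl⟩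
      exact ⟨fun i j => abs_le.1 (hh i j), h.2⟩
    · rintro ⟨h1, h2⟩
      exact ⟨⟨A, h2⟩, fun i j => abs_le.2 (h1 i j), rfl⟩
  rw [this]
  apply IsCompact.inter_right
  · exact IsCompact.matrix (S := Set.Icc (-2 : ℝ) 2) isCompact_Icc
  · exact isClosed_eq (Continuous.matrix_det continuous_id) continuous_const

lemma ruc_of_compact (f : XmodGamma → ℝ) (hf : Continuous f) (hfc : HasCompactSupport f) :
    RUC f := by
  intro ε hε
  set V : Set SL2R := {h : SL2R | ∀ i j, |h.1 i j| ≤ 2}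
  set K : Set XmodGamma := (fun p : XmodGamma × SL2R => rmul p.2⁻¹ p.1) '' (tsupport f ×ˢ V) with hK
  have hKc : IsCompact K := by
    apply (hfc.isCompact.prod near_compact).image
    exact rmul_cont₂.comp (continuous_fst.prodMk continuous_snd.inv)
  have hcont : Continuous (Function.uncurry fun (h : SL2R) (x : XmodGamma) => f (rmul h x)) :=
    hf.comp (rmul_cont₂.comp (continuous_snd.prodMk continuous_fst))
  obtain ⟨v, hv, hv2⟩ := IsCompact.mem_uniformity_of_prod (s := Set.univ) (q := (1 : SL2R)) hKc
    hcont.continuousOn (Set.mem_univ _) (Metric.dist_mem_uniformity hε)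
  rw [nhdsWithin_univ] at hv
  obtain ⟨δ, hδ, h1⟩ := near1_of_nhds hv
  refine ⟨min δ 1, lt_min hδ one_pos, fun h hh g => ?_⟩
  have hhv : h ∈ v := h1 h ⟨hh.1.trans_le (min_le_left _ _), hh.2.1.trans_le (min_le_left _ _),
    hh.2.2.1.trans_le (min_le_left _ _), hh.2.2.2.trans_le (min_le_left _ _)⟩
  by_cases hx : pj g ∈ K
  · have := hv2 h hhv _ hx
    simp only [Set.mem_ofPred_eq, Real.dist_eq, rmul_pj, mul_one] at this
    exact this.le
  · have e1 : f (pj g) = 0 := by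
      by_contra hne
      apply hx
      refine ⟨(pj g, 1), ⟨subset_tsupport f hne, ?_⟩, by simp [rmul_pj]⟩
      intro i j
      fin_cases i <;> fin_cases j <;> simp
    have e2 : f (pj (g * h)) = 0 := by
      by_contra hne
      apply hx
      refine ⟨(pj (g * h), h), ⟨subset_tsupport f hne, ?_⟩, by simp [rmul_pj]⟩
      obtain ⟨a1, a2, a3, a4⟩ := hh
      have m1 := min_le_right δ 1
      rw [abs_lt] at a1 a2 a3 a4
      intro i j
      rw [abs_le]
      fin_cases i <;> fin_cases j <;> constructor <;> simp <;> linarith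
    rw [e1, e2]; simpa using hε.le

lemma mob_sum (n : ℕ) (hn : n ≠ 0) :
    ∑ d ∈ n.divisors, (ArithmeticFunction.moebius d : ℝ) = if n = 1 then 1 else 0 := by
  have h := congrArg (fun F : ArithmeticFunction ℤ => F n) ArithmeticFunction.moebius_mul_coe_zeta
  simp only [ArithmeticFunction.one_apply, ArithmeticFunction.coe_mul_zeta_apply] at h
  exact_mod_cast h

lemma totient_mob (m : ℕ) (hm : 0 < m) :
    ∑ d ∈ m.divisors, (ArithmeticFunction.moebius d : ℝ) / d = (m.totient : ℝ) / m := by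
  have h := (ArithmeticFunction.sum_eq_iff_sum_mul_moebius_eq (R := ℝ)
    (f := fun n => (n.totient : ℝ)) (g := fun n => (n : ℝ))).1
    (fun n hn => by exact_mod_cast Nat.sum_totient n) m hm
  rw [Nat.sum_divisorsAntidiagonal (fun a b => ((ArithmeticFunction.moebius a : ℤ) : ℝ) * (b : ℝ))]
    at h
  rw [← h, Finset.sum_div]
  refine Finset.sum_congr rfl fun d hd => ?_
  have hd' := Nat.dvd_of_mem_divisors hd
  have hd0 : (d : ℝ) ≠ 0 := by
    have := Nat.pos_of_mem_divisors hd
    positivity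
  have hm0 : (m : ℝ) ≠ 0 := by positivity
  rw [Nat.cast_div hd' hd0]
  field_simp

/-- upper bound sieve -/
lemma sieve (m : ℕ) (hm : 0 < m) (a : ℤ) (N : ℕ) :
    (((Finset.Ico a (a + N)).filter (fun k => Int.gcd k m = 1)).card : ℝ)
      ≤ N * ((m.totient : ℝ) / m) + m.divisors.card := by
  have h1 : (((Finset.Ico a (a + N)).filter (fun k => Int.gcd k m = 1)).card : ℝ)
      = ∑ d ∈ m.divisors, (ArithmeticFunction.moebius d : ℝ) *
        ((Finset.Ico a (a + N)).filter (fun k => (d : ℤ) ∣ k)).card := by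
    rw [Finset.card_filter]
    push_cast
    have : ∀ k ∈ Finset.Ico a (a + N), (if Int.gcd k m = 1 then (1 : ℝ) else 0)
        = ∑ d ∈ m.divisors, if (d : ℤ) ∣ k then (ArithmeticFunction.moebius d : ℝ) else 0 := by
      intro k _
      have hg : Int.gcd k m ≠ 0 := by
        intro h
        rw [Int.gcd_eq_zero_iff] at h
        omega
      rw [← mob_sum _ hg, ← Finset.sum_filter]
      apply Finset.sum_congr _ fun _ _ => rfl
      ext d
      simp only [Nat.mem_divisors, Finset.mem_filter]
      constructor
      · rintro ⟨h, -⟩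
        have h2 : (d : ℤ) ∣ Int.gcd k m := by exact_mod_cast h
        exact ⟨⟨by exact_mod_cast h2.trans (Int.gcd_dvd_right _ _), hm.ne'⟩,
          h2.trans (Int.gcd_dvd_left _ _)⟩
      · rintro ⟨⟨h, -⟩, h2⟩
        refine ⟨?_, hg⟩
        have := Int.dvd_coe_gcd h2 (show (d : ℤ) ∣ m by exact_mod_cast h)
        exact_mod_cast this
    rw [Finset.sum_congr rfl this, Finset.sum_comm]
    refine Finset.sum_congr rfl fun d _ => ?_
    rw [← Finset.sum_filter, Finset.sum_const, nsmul_eq_mul, mul_comm]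
  rw [h1, ← totient_mob m hm, Finset.mul_sum,
    show (m.divisors.card : ℝ) = ∑ d ∈ m.divisors, (1 : ℝ) by simp, ← Finset.sum_add_distrib]
  refine Finset.sum_le_sum fun d hd => ?_
  have hd0 := Nat.pos_of_mem_divisors hd
  have hd0' : (0 : ℝ) < d := by exact_mod_cast hd0
  set c := ((Finset.Ico a (a + N)).filter (fun k => (d : ℤ) ∣ k)).card with hc
  have hcard := Int.Ico_filter_dvd_card a (a + N) (r := d) (by exact_mod_cast hd0)
  rw [← hc] at hcard
  have hdiff : |(c : ℝ) - N / d| ≤ 1 := by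
    set X : ℚ := ((a + N : ℤ) : ℚ) / ((d : ℤ) : ℚ) with hX
    set Y : ℚ := (a : ℚ) / ((d : ℤ) : ℚ) with hY
    have e : (N : ℚ) / d = X - Y := by
      rw [hX, hY]; push_cast; ring
    have hXY : Y ≤ X := by
      have : (0 : ℚ) ≤ (N : ℚ) / d := by positivity
      linarith
    have hmono : ⌈Y⌉ ≤ ⌈X⌉ := Int.ceil_mono hXY
    rw [max_eq_left (by omega)] at hcard
    have hq : (c : ℚ) = ⌈X⌉ - ⌈Y⌉ := by exact_mod_cast hcard
    have : |(c : ℚ) - N / d| ≤ 1 := by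
      rw [e, hq, abs_le]
      have := Int.le_ceil X
      have := Int.le_ceil Y
      have := Int.ceil_lt_add_one X
      have := Int.ceil_lt_add_one Y
      constructor <;> linarith
    have h3 := (Rat.cast_le (K := ℝ)).2 this
    push_cast at h3
    exact h3
  have hmu : |(ArithmeticFunction.moebius d : ℝ)| ≤ 1 := by
    exact_mod_cast ArithmeticFunction.abs_moebius_le_one (n := d)
  have : (ArithmeticFunction.moebius d : ℝ) * ((c : ℝ) - N / d) ≤ 1 := by
    refine (le_abs_self _).trans ?_
    rw [abs_mul]
    exact mul_le_one₀ hmu (abs_nonneg _) hdiff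
  have e : (N : ℝ) * ((ArithmeticFunction.moebius d : ℝ) / d)
    = (ArithmeticFunction.moebius d : ℝ) * (N / d) := by ring
  rw [e]
  linarith

lemma le_totient_mul_divisors (m : ℕ) : m ≤ m.divisors.card * m.totient := by
  rcases Nat.eq_zero_or_pos m with rfl | hm
  · simp
  calc m = ∑ d ∈ m.divisors, d.totient := (Nat.sum_totient m).symm
    _ ≤ ∑ d ∈ m.divisors, m.totient := by
        refine Finset.sum_le_sum fun d hd => ?_
        exact Nat.le_of_dvd (Nat.totient_pos.2 hm)
          (Nat.totient_dvd_of_dvd (Nat.dvd_of_mem_divisors hd))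
    _ = _ := by simp

lemma divisor_bound (ε : ℝ) (hε : 0 < ε) :
    ∃ C : ℝ, 0 < C ∧ ∀ m : ℕ, 0 < m → (m.divisors.card : ℝ) ≤ C * (m : ℝ) ^ ε := by
  obtain ⟨P, hP⟩ := exists_nat_gt ((2 : ℝ) ^ (1 / ε))
  set K : ℝ := max 1 (1 / (ε * Real.log 2)) with hK
  have hl2 : 0 < Real.log 2 := Real.log_pos (by norm_num)
  have hK1 : 1 ≤ K := le_max_left _ _
  refine ⟨K ^ P, by positivity, fun m hm => ?_⟩
  rw [Nat.card_divisors hm.ne']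
  push_cast
  have key : ∀ p ∈ m.primeFactors, ((m.factorization p : ℝ) + 1) ≤
      (if p < P then K else 1) * ((p : ℝ) ^ (m.factorization p)) ^ ε := by
    intro p hp
    have hp2 : 2 ≤ p := (Nat.prime_of_mem_primeFactors hp).two_le
    have hp2' : (2 : ℝ) ≤ p := by exact_mod_cast hp2
    set e := m.factorization p
    have hcomm : ((p : ℝ) ^ e) ^ ε = ((p : ℝ) ^ ε) ^ e := by
      rw [← Real.rpow_natCast, ← Real.rpow_natCast, ← Real.rpow_mul (by positivity),
        ← Real.rpow_mul (by positivity), mul_comm]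
    split_ifs with h
    · have h1 : (2 : ℝ) ^ (e * ε) ≤ ((p : ℝ) ^ e) ^ ε := by
        rw [← Real.rpow_natCast, ← Real.rpow_mul (by positivity)]
        exact Real.rpow_le_rpow (by norm_num) hp2' (by positivity)
      have h2 : 1 + e * (ε * Real.log 2) ≤ (2 : ℝ) ^ (e * ε) := by
        rw [Real.rpow_def_of_pos (by norm_num)]
        have := Real.add_one_le_exp (Real.log 2 * (e * ε))
        linarith
      have h3 : (e : ℝ) + 1 ≤ K * (1 + e * (ε * Real.log 2)) := by
        have a1 : 1 ≤ K * (ε * Real.log 2) := by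
          have := le_max_right 1 (1 / (ε * Real.log 2))
          rw [← hK, div_le_iff₀ (by positivity)] at this
          exact this
        have : (e : ℝ) * 1 ≤ e * (K * (ε * Real.log 2)) := by gcongr
        nlinarith
      calc (e : ℝ) + 1 ≤ K * (1 + e * (ε * Real.log 2)) := h3
        _ ≤ K * ((p : ℝ) ^ e) ^ ε := by
          gcongr
          exact h2.trans h1
    · rw [hcomm, one_mul]
      have hpP : (2 : ℝ) ^ (1 / ε) ≤ p := by
        have : (P : ℝ) ≤ p := by exact_mod_cast not_lt.1 h
        linarith
      have h2 : (2 : ℝ) ≤ (p : ℝ) ^ ε := by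
        have := Real.rpow_le_rpow (by positivity) hpP hε.le
        rwa [← Real.rpow_mul (by norm_num), one_div_mul_cancel hε.ne', Real.rpow_one] at this
      have h3 : (e : ℝ) + 1 ≤ (2 : ℝ) ^ e := by
        have := Nat.lt_two_pow_self (n := e)
        exact_mod_cast this
      exact h3.trans (pow_le_pow_left₀ (by norm_num) h2 e)
  refine (Finset.prod_le_prod (fun p _ => by positivity) key).trans ?_
  rw [Finset.prod_mul_distrib, Real.finsetProd_rpow _ _ (fun _ _ => by positivity)]
  have hprod : (∏ p ∈ m.primeFactors, (p : ℝ) ^ (m.factorization p)) = m := by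
    have := Nat.prod_factorization_pow_eq_self hm.ne'
    rw [Finsupp.prod, Nat.support_factorization] at this
    exact_mod_cast this
  rw [hprod]
  gcongr
  rw [Finset.prod_ite]
  simp only [Finset.prod_const, one_pow, mul_one]
  apply pow_le_pow_right₀ hK1
  calc (m.primeFactors.filter (· < P)).card ≤ (Finset.range P).card := by
        apply Finset.card_le_card
        intro p hp
        simp at hp ⊢
        exact hp.2
    _ = P := by simp

lemma divisor_sq_tendsto (c : ℝ) (hc : 0 < c) :
    Tendsto (fun m : ℕ => (m.divisors.card : ℝ) ^ 2 / (m : ℝ) ^ c) atTop (nhds 0) := by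
  obtain ⟨C, hC, h⟩ := divisor_bound (c / 4) (by positivity)
  have h2 : Tendsto (fun m : ℕ => C ^ 2 * (m : ℝ) ^ (-(c / 2))) atTop (nhds (C ^ 2 * 0)) :=
    ((tendsto_rpow_neg_atTop (by positivity)).comp tendsto_natCast_atTop_atTop).const_mul _
  rw [mul_zero] at h2
  refine squeeze_zero' (Eventually.of_forall fun m => by positivity) ?_ h2
  filter_upwards [eventually_gt_atTop 0] with m hm
  have hm' : (0 : ℝ) < m := by exact_mod_cast hm
  rw [div_le_iff₀ (by positivity), mul_assoc, ← Real.rpow_add hm']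
  calc (m.divisors.card : ℝ) ^ 2 ≤ (C * (m : ℝ) ^ (c / 4)) ^ 2 := by
        gcongr
        exact h m hm
    _ = C ^ 2 * (m : ℝ) ^ (-(c / 2) + c) := by
        rw [mul_pow, ← Real.rpow_natCast ((m : ℝ) ^ (c / 4)), ← Real.rpow_mul hm'.le]
        congr 2
        push_cast; ring

section
open scoped Pointwise

/-- first coordinate of `v g` -/
def px (g : SL2R) (v : ℤ × ℤ) : ℝ := v.1 * g.1 0 0 + v.2 * g.1 1 0
/-- second coordinate of `v g` -/
def qx (g : SL2R) (v : ℤ × ℤ) : ℝ := v.1 * g.1 0 1 + v.2 * g.1 1 1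

/-- cone -/
def inCone (β R p q : ℝ) : Prop := 0 < q ∧ q < R ∧ 0 ≤ p ∧ p < β * q

/-- lattice points in a cone -/
def allSet (g : SL2R) (β R : ℝ) : Set (ℤ × ℤ) := {v | inCone β R (px g v) (qx g v)}

/-- primitive lattice points in a cone -/
def primSet (g : SL2R) (β R : ℝ) : Set (ℤ × ℤ) :=
  {v | Int.gcd v.1 v.2 = 1 ∧ inCone β R (px g v) (qx g v)}

/-- the real version -/
def coneS (g : SL2R) (β : ℝ) : Set (Fin 2 → ℝ) :=
  {w | inCone β 1 (w 0 * g.1 0 0 + w 1 * g.1 1 0) (w 0 * g.1 0 1 + w 1 * g.1 1 1)}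

/-- its volume -/
def coneV (β : ℝ) : ℝ := volume.real (coneS 1 β)

lemma coneS_eq_preimage (g : SL2R) (β : ℝ) :
    coneS g β = (Matrix.toLin' (g.1)ᵀ) ⁻¹' (coneS 1 β) := by
  ext w
  simp only [coneS, Set.mem_preimage, Set.mem_ofPred_eq, one00, one01, one10, one11,
    Matrix.toLin'_apply, Matrix.mulVec, dotProduct, Fin.sum_univ_two, Matrix.transpose_apply]
  simp only [mul_one, mul_zero, one_mul, zero_mul, add_zero, zero_add, mul_comm]

lemma coneS_vol (g : SL2R) (β : ℝ) : volume.real (coneS g β) = coneV β := by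
  have hdet : LinearMap.det (Matrix.toLin' (g.1)ᵀ) = 1 := by
    rw [LinearMap.det_toLin', Matrix.det_transpose]; exact g.2
  rw [coneS_eq_preimage, coneV, measureReal_def, measureReal_def,
    Measure.addHaar_preimage_linearMap volume (by rw [hdet]; norm_num), hdet]
  simp

lemma coneS_conv (g : SL2R) (β : ℝ) : Convex ℝ (coneS g β) := by
  intro x hx y hy a b ha hb hab
  obtain ⟨h1, h2, h3, h4⟩ := hx
  obtain ⟨k1, k2, k3, k4⟩ := hy
  simp only [coneS, inCone, Set.mem_ofPred_eq, Pi.add_apply, Pi.smul_apply, smul_eq_mul]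
  set p1 := x 0 * g.1 0 0 + x 1 * g.1 1 0
  set q1 := x 0 * g.1 0 1 + x 1 * g.1 1 1
  set p2 := y 0 * g.1 0 0 + y 1 * g.1 1 0
  set q2 := y 0 * g.1 0 1 + y 1 * g.1 1 1
  have e1 : (a * x 0 + b * y 0) * g.1 0 0 + (a * x 1 + b * y 1) * g.1 1 0 = a * p1 + b * p2 := by
    simp only [p1, p2]; ring
  have e2 : (a * x 0 + b * y 0) * g.1 0 1 + (a * x 1 + b * y 1) * g.1 1 1 = a * q1 + b * q2 := by
    simp only [q1, q2]; ring
  rw [e1, e2]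
  rcases ha.eq_or_lt with rfl | ha'
  · have : b = 1 := by linarith
    subst this
    simp only [zero_mul, zero_add, one_mul]
    exact ⟨k1, k2, k3, k4⟩
  · have hbk : 0 ≤ b * q2 := by positivity
    refine ⟨by positivity, ?_, by positivity, ?_⟩
    · nlinarith
    · nlinarith

lemma coneS_bdd (g : SL2R) (β : ℝ) : Bornology.IsBounded (coneS g β) := by
  rw [Metric.isBounded_iff_subset_closedBall 0]
  refine ⟨(|β| + 1) * (|g.1 0 0| + |g.1 0 1| + |g.1 1 0| + |g.1 1 1|), ?_⟩
  intro w hw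
  obtain ⟨h1, h2, h3, h4⟩ := hw
  have hd := det1 g
  set p := w 0 * g.1 0 0 + w 1 * g.1 1 0 with hp
  set q := w 0 * g.1 0 1 + w 1 * g.1 1 1 with hq
  have e0 : w 0 = p * g.1 1 1 - q * g.1 1 0 := by
    rw [hp, hq]; linear_combination (-(w 0)) * hd
  have e1 : w 1 = q * g.1 0 0 - p * g.1 0 1 := by
    rw [hp, hq]; linear_combination (-(w 1)) * hd
  have hβ : β * q ≤ |β| * 1 := by
    have := le_abs_self β
    have := abs_nonneg β
    nlinarith
  have hpb : |p| ≤ |β| + 1 := by rw [abs_of_nonneg h3]; linarith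
  have hqb : |q| ≤ |β| + 1 := by rw [abs_of_pos h1]; have := abs_nonneg β; linarith
  rw [mem_closedBall_zero_iff, pi_norm_le_iff_of_nonneg (by positivity)]
  have k : ∀ a b : ℝ, |p * a - q * b| ≤ (|β| + 1) * (|a| + |b|) := by
    intro a b
    calc |p * a - q * b| ≤ |p * a| + |q * b| := abs_sub _ _
      _ = |p| * |a| + |q| * |b| := by rw [abs_mul, abs_mul]
      _ ≤ (|β| + 1) * |a| + (|β| + 1) * |b| := by gcongr
      _ = _ := by ring
  intro i
  have b0 := abs_nonneg (g.1 0 0)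
  have b1 := abs_nonneg (g.1 0 1)
  have b2 := abs_nonneg (g.1 1 0)
  have b3 := abs_nonneg (g.1 1 1)
  have b4 : 0 ≤ |β| + 1 := by positivity
  fin_cases i
  · show |w 0| ≤ _
    rw [e0]
    refine (k _ _).trans ?_
    exact mul_le_mul_of_nonneg_left (by linarith) b4
  · show |w 1| ≤ _
    rw [e1, abs_sub_comm]
    refine (k _ _).trans ?_
    exact mul_le_mul_of_nonneg_left (by linarith) b4

lemma coneS_meas (g : SL2R) (β : ℝ) : MeasurableSet (coneS g β) := by
  have m0 : Measurable fun w : Fin 2 → ℝ => w 0 := measurable_pi_apply 0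
  have m1 : Measurable fun w : Fin 2 → ℝ => w 1 := measurable_pi_apply 1
  have mp : Measurable fun w : Fin 2 → ℝ => w 0 * g.1 0 0 + w 1 * g.1 1 0 := by fun_prop
  have mq : Measurable fun w : Fin 2 → ℝ => w 0 * g.1 0 1 + w 1 * g.1 1 1 := by fun_prop
  exact (measurableSet_lt measurable_const mq).inter
    ((measurableSet_lt mq measurable_const).inter
    ((measurableSet_le measurable_const mp).inter (measurableSet_lt mp (mq.const_mul β))))

lemma coneS_star (g : SL2R) (β : ℝ) ⦃x y : ℝ⦄ (hx : 0 < x) (hxy : x ≤ y) :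
    x • coneS g β ⊆ y • coneS g β := by
  rintro _ ⟨w, ⟨h1, h2, h3, h4⟩, rfl⟩
  have hy : 0 < y := hx.trans_le hxy
  refine ⟨(x / y) • w, ?_, ?_⟩
  · have hr : 0 < x / y := by positivity
    have hr1 : x / y ≤ 1 := (div_le_one hy).2 hxy
    simp only [coneS, inCone, Set.mem_ofPred_eq, Pi.smul_apply, smul_eq_mul]
    set r := x / y
    have e1 : r * w 0 * g.1 0 0 + r * w 1 * g.1 1 0 = r * (w 0 * g.1 0 0 + w 1 * g.1 1 0) := by ring
    have e2 : r * w 0 * g.1 0 1 + r * w 1 * g.1 1 1 = r * (w 0 * g.1 0 1 + w 1 * g.1 1 1) := by ring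
    rw [e1, e2]
    refine ⟨by positivity, by nlinarith, by positivity, ?_⟩
    nlinarith
  · simp only [smul_smul]
    congr 1
    field_simp

lemma coneV_pos (β : ℝ) (hβ : 0 < β) : 0 < coneV β := by
  rw [coneV, measureReal_def, ENNReal.toReal_pos_iff]
  refine ⟨?_, (coneS_bdd 1 β).measure_lt_top⟩
  set U : Set (Fin 2 → ℝ) := {w | 0 < w 1 ∧ w 1 < 1 ∧ 0 < w 0 ∧ w 0 < β * w 1}
  have hU : IsOpen U := by
    have m0 : Continuous fun w : Fin 2 → ℝ => w 0 := continuous_apply 0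
    have m1 : Continuous fun w : Fin 2 → ℝ => w 1 := continuous_apply 1
    exact (isOpen_lt continuous_const m1).inter ((isOpen_lt m1 continuous_const).inter
      ((isOpen_lt continuous_const m0).inter (isOpen_lt m0 (m1.const_mul β))))
  have hne : U.Nonempty := ⟨![β / 4, 1 / 2], by
    simp only [U, Set.mem_ofPred_eq, Matrix.cons_val_zero, Matrix.cons_val_one]
    refine ⟨by norm_num, by norm_num, by positivity, by linarith⟩⟩
  refine (hU.measure_pos volume hne).trans_le (measure_mono ?_)
  rintro w ⟨h1, h2, h3, h4⟩
  simp only [coneS, inCone, Set.mem_ofPred_eq, one00, one01, one10, one11]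
  simp only [mul_one, mul_zero, add_zero, zero_add]
  exact ⟨h1, h2, h3.le, h4⟩

/-- embedding of lattice points -/
def emb (x : ℝ) (v : ℤ × ℤ) : Fin 2 → ℝ := x⁻¹ • ![(v.1 : ℝ), (v.2 : ℝ)]

lemma emb_inj (x : ℝ) (hx : 0 < x) : Function.Injective (emb x) := by
  intro v w h
  unfold emb at h
  have h' := smul_right_injective _ (inv_ne_zero hx.ne') h
  have h0 := congrFun h' 0
  have h1 := congrFun h' 1
  simp at h0 h1
  exact Prod.ext h0 h1

lemma coneS_inter (g : SL2R) (β x : ℝ) (hx : 0 < x) :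
    coneS g β ∩ x⁻¹ • ((Submodule.span ℤ (Set.range (Pi.basisFun ℝ (Fin 2)))) : Set (Fin 2 → ℝ))
      = emb x '' allSet g β x := by
  have key : ∀ v : ℤ × ℤ, emb x v ∈ coneS g β ↔ v ∈ allSet g β x := by
    intro v
    simp only [coneS, allSet, inCone, Set.mem_ofPred_eq, emb, Pi.smul_apply, smul_eq_mul,
      Matrix.cons_val_zero, Matrix.cons_val_one]
    have e1 : x⁻¹ * (v.1 : ℝ) * g.1 0 0 + x⁻¹ * (v.2 : ℝ) * g.1 1 0 = px g v / x := by
      unfold px; ring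
    have e2 : x⁻¹ * (v.1 : ℝ) * g.1 0 1 + x⁻¹ * (v.2 : ℝ) * g.1 1 1 = qx g v / x := by
      unfold qx; ring
    rw [e1, e2, ← mul_div_assoc, div_lt_div_iff_of_pos_right hx, div_lt_one hx]
    simp only [div_pos_iff_of_pos_right hx]
    have : 0 ≤ px g v / x ↔ 0 ≤ px g v := by
      rw [le_div_iff₀ hx, zero_mul]
    rw [this]
  ext w
  constructor
  · rintro ⟨hw, z, hz, rfl⟩
    have hz' := (Module.Basis.mem_span_iff_repr_mem ℤ (Pi.basisFun ℝ (Fin 2)) z).1 hz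
    obtain ⟨a, ha⟩ := hz' 0
    obtain ⟨b, hb⟩ := hz' 1
    have hzv : x⁻¹ • z = emb x (a, b) := by
      unfold emb
      congr 1
      ext i
      fin_cases i
      · simpa using ha.symm
      · simpa using hb.symm
    refine ⟨(a, b), ?_, hzv.symm⟩
    have hw' : x⁻¹ • z ∈ coneS g β := hw
    rw [hzv] at hw'
    exact (key _).1 hw'
  · rintro ⟨v, hv, rfl⟩
    refine ⟨(key _).2 hv, ?_⟩
    refine ⟨![(v.1 : ℝ), (v.2 : ℝ)], ?_, rfl⟩
    refine (Module.Basis.mem_span_iff_repr_mem ℤ (Pi.basisFun ℝ (Fin 2)) _).2 ?_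
    intro i
    fin_cases i
    · exact ⟨v.1, by simp⟩
    · exact ⟨v.2, by simp⟩

lemma allSet_tendsto (g : SL2R) (β : ℝ) :
    Tendsto (fun R : ℝ => ((allSet g β R).ncard : ℝ) / R ^ 2) atTop (nhds (coneV β)) := by
  have h := tendsto_card_div_pow_atTop_volume' (coneS g β) (coneS_bdd g β) (coneS_meas g β)
    ((coneS_conv g β).addHaar_frontier volume) (coneS_star g β)
  rw [coneS_vol, Fintype.card_fin] at h
  refine h.congr' ?_
  filter_upwards [eventually_gt_atTop 0] with x hx
  rw [coneS_inter g β x hx]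
  congr 2
  rw [Nat.card_coe_set_eq, Set.ncard_image_of_injective _ (emb_inj x hx)]

lemma allSet_mono (g : SL2R) (β : ℝ) {R R' : ℝ} (h : R ≤ R') : allSet g β R ⊆ allSet g β R' :=
  fun _ hv => ⟨hv.1, hv.2.1.trans_le h, hv.2.2⟩

lemma allSet_fin (g : SL2R) (β R : ℝ) : (allSet g β R).Finite := by
  refine Set.Finite.subset ?_ (allSet_mono g β (le_max_left R 1))
  have hx : 0 < max R 1 := by positivity
  have : (emb (max R 1) '' allSet g β (max R 1)).Finite := by
    have hx' := hx.ne'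
    rw [← coneS_inter g β _ hx]
    have h1 := ZSpan.setFinite_inter (Pi.basisFun ℝ (Fin 2)) ((coneS_bdd g β).smul₀ (max R 1))
    have h2 := h1.smul_set (a := (max R 1)⁻¹)
    refine h2.subset ?_
    rintro w ⟨hw, z, hz, rfl⟩
    refine ⟨z, ⟨⟨_, hw, ?_⟩, hz⟩, rfl⟩
    simp [smul_smul, hx']
  exact this.of_finite_image (emb_inj _ hx).injOn

lemma allSet_bound (g : SL2R) (β : ℝ) (hβ : 0 < β) :
    ∃ C : ℝ, ∀ R : ℝ, 0 ≤ R → ((allSet g β R).ncard : ℝ) ≤ C * R ^ 2 := by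
  have h1 : ∀ᶠ R : ℝ in atTop, ((allSet g β R).ncard : ℝ) / R ^ 2 < coneV β + 1 :=
    (allSet_tendsto g β).eventually_lt_const (by linarith)
  obtain ⟨R0, hR0⟩ := (h1.and (eventually_ge_atTop 1)).exists_forall_of_atTop
  set V := coneV β + 1
  have hV : 0 < V := by have := coneV_pos β hβ; positivity
  have hR0' : 1 ≤ R0 := (hR0 R0 le_rfl).2
  obtain ⟨ρ, hρ, hemp⟩ : ∃ ρ > 0, allSet g β ρ = ∅ := by
    rcases (allSet g β 1).eq_empty_or_nonempty with h | h
    · exact ⟨1, one_pos, h⟩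
    · obtain ⟨v, hv, hmin⟩ := Set.exists_min_image _ (qx g) (allSet_fin g β 1) h
      refine ⟨qx g v, hv.1, ?_⟩
      ext w
      simp only [Set.mem_empty_iff_false, iff_false]
      intro hw
      have := hmin w ⟨hw.1, hw.2.1.trans hv.2.1, hw.2.2⟩
      exact absurd hw.2.1 (not_lt.2 this)
  have hbig : ∀ R, R0 ≤ R → ((allSet g β R).ncard : ℝ) ≤ V * R ^ 2 := by
    intro R hR
    have := (hR0 R hR).1.le
    rwa [div_le_iff₀ (by have := hR0'.trans hR; positivity)] at this
  refine ⟨V + V * R0 ^ 2 / ρ ^ 2, fun R hR => ?_⟩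
  rcases le_or_gt R0 R with h | h
  · refine (hbig R h).trans ?_
    gcongr
    have : 0 ≤ V * R0 ^ 2 / ρ ^ 2 := by positivity
    linarith
  · rcases le_or_gt R ρ with h' | h'
    · have : allSet g β R = ∅ := Set.subset_empty_iff.1 (hemp ▸ allSet_mono g β h')
      rw [this]; simp; positivity
    · have : ((allSet g β R).ncard : ℝ) ≤ (allSet g β R0).ncard := by
        exact_mod_cast Set.ncard_le_ncard (allSet_mono g β h.le) (allSet_fin _ _ _)
      refine this.trans ((hbig R0 le_rfl).trans ?_)
      have a1 : 1 ≤ R ^ 2 / ρ ^ 2 := by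
        rw [one_le_div (by positivity)]; gcongr
      have a2 : V * R0 ^ 2 ≤ V * R0 ^ 2 * (R ^ 2 / ρ ^ 2) :=
        le_mul_of_one_le_right (by positivity) a1
      have a3 : 0 ≤ V * R ^ 2 := by positivity
      calc V * R0 ^ 2 ≤ V * R ^ 2 + V * R0 ^ 2 * (R ^ 2 / ρ ^ 2) := by linarith
        _ = _ := by ring

lemma allSet_dvd (g : SL2R) (β R : ℝ) (d : ℕ) (hd : 0 < d) :
    (allSet g β R ∩ {v | d ∣ Int.gcd v.1 v.2}).ncard = (allSet g β (R / d)).ncard := by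
  have hd' : (0 : ℝ) < d := by exact_mod_cast hd
  have : allSet g β R ∩ {v | d ∣ Int.gcd v.1 v.2}
      = (fun v : ℤ × ℤ => ((d : ℤ) * v.1, (d : ℤ) * v.2)) '' allSet g β (R / d) := by
    have key : ∀ w : ℤ × ℤ, ((d : ℤ) * w.1, (d : ℤ) * w.2) ∈ allSet g β R ↔
        w ∈ allSet g β (R / d) := by
      intro w
      have e1 : px g ((d : ℤ) * w.1, (d : ℤ) * w.2) = d * px g w := by
        unfold px; push_cast; ring
      have e2 : qx g ((d : ℤ) * w.1, (d : ℤ) * w.2) = d * qx g w := by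
        unfold qx; push_cast; ring
      simp only [allSet, inCone, Set.mem_ofPred_eq, e1, e2, lt_div_iff₀ hd']
      rw [mul_pos_iff_of_pos_left hd', mul_nonneg_iff_of_pos_left hd', mul_left_comm,
        mul_lt_mul_iff_right₀ hd', mul_comm (d : ℝ)]
    ext v
    constructor
    · rintro ⟨hv, hdv⟩
      have hdv' : (d : ℤ) ∣ (Int.gcd v.1 v.2 : ℤ) := by exact_mod_cast hdv
      obtain ⟨a, ha⟩ := hdv'.trans (Int.gcd_dvd_left _ _)
      obtain ⟨b, hb⟩ := hdv'.trans (Int.gcd_dvd_right _ _)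
      have hvv : ((d : ℤ) * (a, b).1, (d : ℤ) * (a, b).2) = v := Prod.ext ha.symm hb.symm
      refine ⟨(a, b), (key _).1 ?_, hvv⟩
      rw [hvv]; exact hv
    · rintro ⟨w, hw, rfl⟩
      refine ⟨(key w).2 hw, ?_⟩
      have := Int.dvd_coe_gcd (Dvd.intro w.1 rfl : (d : ℤ) ∣ (d : ℤ) * w.1)
        (Dvd.intro w.2 rfl : (d : ℤ) ∣ (d : ℤ) * w.2)
      exact_mod_cast this
  rw [this, Set.ncard_image_of_injective]
  intro v w h
  have hd0 : (d : ℤ) ≠ 0 := by exact_mod_cast hd.ne'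
  simp only [Prod.mk.injEq] at h
  exact Prod.ext (mul_left_cancel₀ hd0 h.1) (mul_left_cancel₀ hd0 h.2)

lemma prim_moebius (g : SL2R) (β R : ℝ) :
    ((primSet g β R).ncard : ℝ) =
      ∑' d : ℕ, (ArithmeticFunction.moebius d : ℝ) * ((allSet g β (R / d)).ncard : ℝ) := by
  classical
  set A := (allSet_fin g β R).toFinset with hA
  have hgcd : ∀ v ∈ A, Int.gcd v.1 v.2 ≠ 0 := by
    intro v hv h
    rw [Int.gcd_eq_zero_iff] at h
    have hq := ((allSet_fin g β R).mem_toFinset.1 hv).1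
    simp [qx, h.1, h.2] at hq
  set M := A.sup (fun v => Int.gcd v.1 v.2) + 1 with hM
  have hlt : ∀ v ∈ A, Int.gcd v.1 v.2 < M := fun v hv =>
    Nat.lt_succ_of_le (Finset.le_sup (f := fun v : ℤ × ℤ => Int.gcd v.1 v.2) hv)
  have hcount : ∀ d : ℕ, 0 < d → ((allSet g β (R / d)).ncard)
      = (A.filter (fun v => d ∣ Int.gcd v.1 v.2)).card := by
    intro d hd
    rw [← allSet_dvd g β R d hd, ← Set.ncard_coe_finset]
    congr 1
    ext v
    simp [hA]
  rw [tsum_eq_sum (s := Finset.range M)]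
  · have h1 : (primSet g β R).ncard = (A.filter (fun v => Int.gcd v.1 v.2 = 1)).card := by
      rw [← Set.ncard_coe_finset]
      congr 1
      ext v
      simp [hA, primSet, allSet, and_comm]
    rw [h1, Finset.card_filter]
    push_cast
    have h2 : ∀ v ∈ A, (if Int.gcd v.1 v.2 = 1 then (1 : ℝ) else 0)
        = ∑ d ∈ Finset.range M, if d ∣ Int.gcd v.1 v.2 then
          (ArithmeticFunction.moebius d : ℝ) else 0 := by
      intro v hv
      rw [← mob_sum _ (hgcd v hv), ← Finset.sum_filter]
      apply Finset.sum_congr _ fun _ _ => rfl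
      ext d
      simp only [Nat.mem_divisors, Finset.mem_filter, Finset.mem_range]
      constructor
      · rintro ⟨h, -⟩
        exact ⟨(Nat.le_of_dvd (Nat.pos_of_ne_zero (hgcd v hv)) h).trans_lt (hlt v hv), h⟩
      · rintro ⟨-, h⟩
        exact ⟨h, hgcd v hv⟩
    rw [Finset.sum_congr rfl h2, Finset.sum_comm]
    refine Finset.sum_congr rfl fun d _ => ?_
    rcases Nat.eq_zero_or_pos d with rfl | hd
    · simp
    · rw [hcount d hd, ← Finset.sum_filter, Finset.sum_const, nsmul_eq_mul, mul_comm]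
  · intro d hd
    have hd' : M ≤ d := by simpa using hd
    have hd0 : 0 < d := by omega
    rw [hcount d hd0]
    have : A.filter (fun v => d ∣ Int.gcd v.1 v.2) = ∅ := by
      rw [Finset.filter_eq_empty_iff]
      intro v hv h
      have := Nat.le_of_dvd (Nat.pos_of_ne_zero (hgcd v hv)) h
      have := hlt v hv
      omega
    rw [this]; simp

/-- `1/ζ(2)` -/
def mobC : ℝ := ∑' d : ℕ, (ArithmeticFunction.moebius d : ℝ) / (d : ℝ) ^ 2

lemma mob_abs (d : ℕ) : |(ArithmeticFunction.moebius d : ℝ)| ≤ 1 := by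
  exact_mod_cast ArithmeticFunction.abs_moebius_le_one (n := d)

lemma mob_summable : Summable fun d : ℕ => (ArithmeticFunction.moebius d : ℝ) / (d : ℝ) ^ 2 := by
  refine Summable.of_norm_bounded hasSum_zeta_two.summable fun d => ?_
  rw [norm_div, Real.norm_eq_abs, Real.norm_eq_abs, abs_of_nonneg (by positivity : (0 : ℝ) ≤ (d : ℝ) ^ 2)]
  gcongr
  exact mob_abs d

lemma mobC_pos : 0 < mobC := by
  have h1 := mob_summable.hasSum.add hasSum_zeta_two
  have h2 : (2 : ℝ) ≤ mobC + Real.pi ^ 2 / 6 := by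
    have := le_hasSum h1 1 (fun d _ => ?_)
    · simpa [mobC] using (by norm_num at this ⊢; exact this)
    · rw [← add_div]
      have := (abs_le.1 (mob_abs d)).1
      apply div_nonneg <;> [linarith; positivity]
  have h3 : Real.pi ^ 2 < 12 := by
    have := Real.pi_lt_d2
    have := Real.pi_pos
    nlinarith
  linarith

lemma prim_tendsto (g : SL2R) (β : ℝ) (hβ : 0 < β) :
    Tendsto (fun R : ℝ => ((primSet g β R).ncard : ℝ) / R ^ 2) atTop
      (nhds (mobC * coneV β)) := by
  obtain ⟨C, hC⟩ := allSet_bound g β hβ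
  have hC0 : 0 ≤ C := by have := hC 1 (by norm_num); norm_num at this; linarith [Nat.cast_nonneg (α := ℝ) (allSet g β 1).ncard]
  have h := tendsto_tsum_of_dominated_convergence (𝓕 := (atTop : Filter ℝ))
    (f := fun (R : ℝ) (d : ℕ) => (ArithmeticFunction.moebius d : ℝ) *
      ((allSet g β (R / d)).ncard : ℝ) / R ^ 2)
    (g := fun d : ℕ => (ArithmeticFunction.moebius d : ℝ) / (d : ℝ) ^ 2 * coneV β)
    (bound := fun d : ℕ => C * (1 / (d : ℝ) ^ 2))
    (hasSum_zeta_two.summable.mul_left C) ?_ ?_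
  · rw [tsum_mul_right] at h
    refine h.congr fun R => ?_
    rw [prim_moebius, tsum_div_const]
  · intro d
    rcases Nat.eq_zero_or_pos d with rfl | hd
    · simp
    · have hd' : (0 : ℝ) < d := by exact_mod_cast hd
      have h1 := ((allSet_tendsto g β).comp (tendsto_id.atTop_div_const hd')).const_mul
        ((ArithmeticFunction.moebius d : ℝ) / (d : ℝ) ^ 2)
      refine h1.congr' ?_
      filter_upwards [eventually_gt_atTop 0] with R hR
      simp only [Function.comp, id]
      field_simp
  · filter_upwards [eventually_gt_atTop 0] with R hR d
    rcases Nat.eq_zero_or_pos d with rfl | hd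
    · simp
    have hd' : (0 : ℝ) < d := by exact_mod_cast hd
    rw [norm_div, norm_mul, Real.norm_eq_abs, Real.norm_eq_abs, Real.norm_eq_abs,
      abs_of_nonneg (by positivity : (0 : ℝ) ≤ R ^ 2),
      abs_of_nonneg (by positivity : (0 : ℝ) ≤ ((allSet g β (R / d)).ncard : ℝ)),
      div_le_iff₀ (by positivity)]
    calc |(ArithmeticFunction.moebius d : ℝ)| * ((allSet g β (R / d)).ncard : ℝ)
        ≤ 1 * (C * (R / d) ^ 2) := by
          gcongr
          · exact mob_abs d
          · exact hC _ (by positivity)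
      _ = C * (1 / (d : ℝ) ^ 2) * R ^ 2 := by field_simp

end

instance instMeasSL : MeasurableSpace SL2R := borel SL2R
instance instBorelSL : BorelSpace SL2R := ⟨rfl⟩

lemma val_closedEmb : Topology.IsClosedEmbedding
    (fun g : SL2R => (g : Matrix (Fin 2) (Fin 2) ℝ)) := by
  refine ⟨⟨⟨rfl⟩, Subtype.val_injective⟩, ?_⟩
  have : Set.range (fun g : SL2R => (g : Matrix (Fin 2) (Fin 2) ℝ))
      = {A : Matrix (Fin 2) (Fin 2) ℝ | A.det = 1} := by
    ext A
    constructor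
    · rintro ⟨g, rfl⟩; exact g.2
    · intro h; exact ⟨⟨A, h⟩, rfl⟩
  rw [this]
  exact isClosed_eq (Continuous.matrix_det continuous_id) continuous_const

instance instPolishMat : PolishSpace (Matrix (Fin 2) (Fin 2) ℝ) :=
  (inferInstance : PolishSpace (Fin 2 → Fin 2 → ℝ))

instance instPolishSL : PolishSpace SL2R := val_closedEmb.polishSpace

instance instSCX : SecondCountableTopology XmodGamma :=
  pj_openQuot.isQuotientMap.secondCountableTopology pj_isOpenMap

lemma int_mat (k : SL2R) (h : ∀ i j, k.1 i j ∈ Set.range (Int.cast : ℤ → ℝ)) :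
    ∃ γ, zmat γ = k := by
  choose a ha using h
  have hd : (Matrix.of a).det = 1 := by
    have h1 := det1 k
    rw [← ha, ← ha, ← ha, ← ha] at h1
    rw [Matrix.det_fin_two]
    exact_mod_cast h1
  refine ⟨⟨Matrix.of a, hd⟩, ?_⟩
  ext i j
  exact (zmat_apply _ i j).trans (ha i j)

instance instT1X : T1Space XmodGamma := by
  refine ⟨fun x => ?_⟩
  obtain ⟨g, rfl⟩ := pj_surj x
  rw [← pj_openQuot.isQuotientMap.isClosed_preimage]
  have : pj ⁻¹' {pj g} = ⋂ i, ⋂ j, (fun h : SL2R => (h * g⁻¹).1 i j) ⁻¹'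
      (Set.range (Int.cast : ℤ → ℝ)) := by
    ext h
    simp only [Set.mem_preimage, Set.mem_singleton_iff, Set.mem_iInter]
    constructor
    · intro hh i j
      obtain ⟨γ, hγ⟩ := (pj_eq_iff _ _).1 hh.symm
      have : h * g⁻¹ = zmat γ := by rw [hγ]; simp
      rw [this, zmat_apply]
      exact ⟨_, rfl⟩
    · intro hh
      obtain ⟨γ, hγ⟩ := int_mat _ hh
      refine ((pj_eq_iff _ _).2 ⟨γ, ?_⟩).symm
      rw [hγ]; simp
  rw [this]
  refine isClosed_iInter fun i => isClosed_iInter fun j => ?_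
  exact Int.isClosedEmbedding_coe_real.isClosed_range.preimage
    ((entry_cont i j).comp (continuous_mul_const _))

lemma meas_of_pj {β : Type*} [MeasurableSpace β] {F : XmodGamma → β}
    (h : Measurable fun g : SL2R => F (pj g)) : Measurable F :=
  (Measurable.measurable_comp_iff_of_surjective pj_cont.measurable pj_surj).1 h

/-- box in cone coordinates -/
def Bx (Q R r1 r2 p q : ℝ) : Prop := 0 < q ∧ Q ≤ q ∧ q < R ∧ r1 * q ≤ p ∧ p < r2 * q

/-- primitive vectors in the box -/
def bset (Q R r1 r2 : ℝ) (g : SL2R) : Set (ℤ × ℤ) :=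
  {v | Int.gcd v.1 v.2 = 1 ∧ Bx Q R r1 r2 (px g v) (qx g v)}

/-- number of primitive vectors in the box -/
def NG (Q R r1 r2 : ℝ) (g : SL2R) : ENNReal :=
  ∑' v : ℤ × ℤ, (bset Q R r1 r2 g).indicator 1 v

/-- action on row vectors -/
def rowact (γ : Matrix.SpecialLinearGroup (Fin 2) ℤ) (v : ℤ × ℤ) : ℤ × ℤ :=
  (v.1 * γ.1 0 0 + v.2 * γ.1 1 0, v.1 * γ.1 0 1 + v.2 * γ.1 1 1)

lemma detZ (γ : Matrix.SpecialLinearGroup (Fin 2) ℤ) :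
    γ.1 0 0 * γ.1 1 1 - γ.1 0 1 * γ.1 1 0 = 1 := by
  rw [← Matrix.det_fin_two]; exact γ.2

lemma rowact_inj (γ : Matrix.SpecialLinearGroup (Fin 2) ℤ) : Function.Injective (rowact γ) := by
  intro v w h
  have hd := detZ γ
  simp only [rowact, Prod.mk.injEq] at h
  obtain ⟨h1, h2⟩ := h
  refine Prod.ext ?_ ?_
  · linear_combination (-(v.1 - w.1)) * hd + γ.1 1 1 * h1 - γ.1 1 0 * h2
  · linear_combination (-(v.2 - w.2)) * hd - γ.1 0 1 * h1 + γ.1 0 0 * h2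

lemma rowact_cop (γ : Matrix.SpecialLinearGroup (Fin 2) ℤ) (v : ℤ × ℤ)
    (h : Int.gcd v.1 v.2 = 1) : Int.gcd (rowact γ v).1 (rowact γ v).2 = 1 := by
  rw [← Int.isCoprime_iff_gcd_eq_one] at h ⊢
  obtain ⟨a, b, hab⟩ := h
  have hd := detZ γ
  refine ⟨a * γ.1 1 1 - b * γ.1 0 1, b * γ.1 0 0 - a * γ.1 1 0, ?_⟩
  simp only [rowact]
  linear_combination (a * v.1 + b * v.2) * hd + hab

lemma px_zmat (γ) (g : SL2R) (v : ℤ × ℤ) : px (zmat γ * g) v = px g (rowact γ v) := by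
  simp only [px, rowact, mul00, mul10, zmat_apply]; push_cast; ring

lemma qx_zmat (γ) (g : SL2R) (v : ℤ × ℤ) : qx (zmat γ * g) v = qx g (rowact γ v) := by
  simp only [qx, rowact, mul01, mul11, zmat_apply]; push_cast; ring

lemma NG_zmat_le (Q R r1 r2 : ℝ) (γ) (g : SL2R) :
    NG Q R r1 r2 (zmat γ * g) ≤ NG Q R r1 r2 g := by
  unfold NG
  refine le_trans (ENNReal.tsum_le_tsum fun v => ?_)
    (ENNReal.tsum_comp_le_tsum_of_injective (rowact_inj γ) _)
  refine Set.indicator_apply_le' (fun hv => ?_) (fun _ => zero_le)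
  rw [Set.indicator_of_mem]
  · rfl
  · refine ⟨rowact_cop γ v hv.1, ?_⟩
    rw [← px_zmat, ← qx_zmat]; exact hv.2

lemma zmat_mul (γ γ') : zmat (γ * γ') = zmat γ * zmat γ' := map_mul _ _ _
lemma zmat_one : zmat 1 = 1 := map_one _

lemma NG_zmat (Q R r1 r2 : ℝ) (γ) (g : SL2R) :
    NG Q R r1 r2 (zmat γ * g) = NG Q R r1 r2 g := by
  refine le_antisymm (NG_zmat_le _ _ _ _ _ _) ?_
  have h := NG_zmat_le Q R r1 r2 γ⁻¹ (zmat γ * g)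
  rwa [← mul_assoc, ← zmat_mul, inv_mul_cancel, zmat_one, one_mul] at h

/-- number of primitive vectors in the box, on the quotient -/
def NX (Q R r1 r2 : ℝ) (x : XmodGamma) : ENNReal := NG Q R r1 r2 (Function.surjInv pj_surj x)

lemma NX_pj (Q R r1 r2 : ℝ) (g : SL2R) : NX Q R r1 r2 (pj g) = NG Q R r1 r2 g := by
  obtain ⟨γ, hγ⟩ := (pj_eq_iff _ _).1 (Function.surjInv_eq pj_surj (pj g))
  rw [NX]
  rw [← NG_zmat Q R r1 r2 γ, ← hγ]

lemma px_meas (v : ℤ × ℤ) : Continuous fun g : SL2R => px g v :=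
  ((entry_cont 0 0).const_mul _).add ((entry_cont 1 0).const_mul _)
lemma qx_meas (v : ℤ × ℤ) : Continuous fun g : SL2R => qx g v :=
  ((entry_cont 0 1).const_mul _).add ((entry_cont 1 1).const_mul _)

lemma NX_meas (Q R r1 r2 : ℝ) : Measurable (NX Q R r1 r2) := by
  apply meas_of_pj
  simp only [NX_pj, NG]
  refine Measurable.tsum fun v => ?_
  have hm : MeasurableSet {g : SL2R | v ∈ bset Q R r1 r2 g} := by
    have hp := (px_meas v).measurable
    have hq := (qx_meas v).measurable
    by_cases hv : Int.gcd v.1 v.2 = 1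
    · simp only [bset, Set.mem_ofPred_eq, hv, true_and, Bx]
      exact (measurableSet_lt measurable_const hq).inter
        ((measurableSet_le measurable_const hq).inter
        ((measurableSet_lt hq measurable_const).inter
        ((measurableSet_le (hq.const_mul _) hp).inter (measurableSet_lt hp (hq.const_mul _)))))
    · simp [bset, hv]
  have : (fun g : SL2R => (bset Q R r1 r2 g).indicator (1 : ℤ × ℤ → ENNReal) v)
      = {g : SL2R | v ∈ bset Q R r1 r2 g}.indicator 1 := by
    ext g
    by_cases hv : v ∈ bset Q R r1 r2 g
    · rw [Set.indicator_of_mem hv, Set.indicator_of_mem (by exact hv)]; rfl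
    · rw [Set.indicator_of_notMem hv, Set.indicator_of_notMem (by exact hv)]
  rw [this]
  exact measurable_one.indicator hm

lemma NG_eq_encard (Q R r1 r2 : ℝ) (g : SL2R) :
    NG Q R r1 r2 g = ((bset Q R r1 r2 g).encard : ENNReal) := by
  rw [NG, ← tsum_subtype, ← ENNReal.tsum_set_one]; rfl

/-- representative with bottom row in the box -/
lemma NX_rep (Q R r1 r2 : ℝ) (x : XmodGamma) (h : NX Q R r1 r2 x ≠ 0) :
    ∃ g, pj g = x ∧ Bx Q R r1 r2 (g.1 1 0) (g.1 1 1) := by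
  obtain ⟨g, rfl⟩ := pj_surj x
  rw [NX_pj, NG_eq_encard] at h
  have hne : (bset Q R r1 r2 g).Nonempty := by
    by_contra hc
    rw [Set.not_nonempty_iff_eq_empty] at hc
    simp [hc] at h
  obtain ⟨v, hv, hb⟩ := hne
  rw [← Int.isCoprime_iff_gcd_eq_one] at hv
  obtain ⟨a, b, hab⟩ := hv
  have hdet : (!![b, -a; v.1, v.2] : Matrix (Fin 2) (Fin 2) ℤ).det = 1 := by
    rw [Matrix.det_fin_two_of]; linarith
  set γ : Matrix.SpecialLinearGroup (Fin 2) ℤ := ⟨!![b, -a; v.1, v.2], hdet⟩ with hγ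
  have c1 : γ.1 1 0 = v.1 := rfl
  have c2 : γ.1 1 1 = v.2 := rfl
  refine ⟨zmat γ * g, pj_zmat_mul _ _, ?_⟩
  rw [mul10, mul11, zmat_apply, zmat_apply, c1, c2]
  exact hb

/-- narrow boxes contain at most one primitive vector -/
lemma bset_subsing (Q R r1 r2 : ℝ) (hr : (r2 - r1) * R ^ 2 ≤ 1) (g : SL2R) :
    (bset Q R r1 r2 g).Subsingleton := by
  rintro v ⟨hv, v0, v1, v2, v3, v4⟩ w ⟨hw, w0, w1, w2, w3, w4⟩
  have hd := det1 g
  have hdet : px g v * qx g w - px g w * qx g v = ((v.1 * w.2 - w.1 * v.2 : ℤ) : ℝ) := by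
    unfold px qx; push_cast; linear_combination ((v.1 : ℝ) * w.2 - w.1 * v.2) * hd
  set p := px g v
  set q := qx g v
  set p' := px g w
  set q' := qx g w
  have hR : 0 < R := v0.trans v2
  have hqq : q * q' ≤ R ^ 2 := by
    have := mul_le_mul v2.le w2.le w0.le hR.le
    nlinarith
  have hrr : 0 < r2 - r1 := by
    have : r1 * q < r2 * q := v3.trans_lt v4
    have := lt_of_mul_lt_mul_right this v0.le
    linarith
  have hb : (r2 - r1) * (q * q') ≤ 1 := le_trans (by gcongr) hr
  have u1 : p * q' - p' * q < (r2 - r1) * (q * q') := by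
    nlinarith [mul_lt_mul_of_pos_right v4 w0, mul_le_mul_of_nonneg_right w3 v0.le]
  have u2 : -((r2 - r1) * (q * q')) < p * q' - p' * q := by
    nlinarith [mul_lt_mul_of_pos_right w4 v0, mul_le_mul_of_nonneg_right v3 w0.le]
  have z : v.1 * w.2 - w.1 * v.2 = 0 := by
    have z1 : ((v.1 * w.2 - w.1 * v.2 : ℤ) : ℝ) < 1 := by rw [← hdet]; linarith
    have z2 : (-1 : ℝ) < ((v.1 * w.2 - w.1 * v.2 : ℤ) : ℝ) := by rw [← hdet]; linarith
    have z1' : v.1 * w.2 - w.1 * v.2 < 1 := by exact_mod_cast z1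
    have z2' : -1 < v.1 * w.2 - w.1 * v.2 := by exact_mod_cast z2
    omega
  rw [← Int.isCoprime_iff_gcd_eq_one] at hv hw
  obtain ⟨a, b, hab⟩ := hv
  obtain ⟨c, d, hcd⟩ := hw
  -- w = k v with k = a w1 + b w2
  have k1 : w.1 = (a * w.1 + b * w.2) * v.1 := by linear_combination (-w.1) * hab - b * z
  have k2 : w.2 = (a * w.1 + b * w.2) * v.2 := by linear_combination (-w.2) * hab + a * z
  set k := a * w.1 + b * w.2
  have hk : k * (c * v.1 + d * v.2) = 1 := by
    rw [← hcd]; linear_combination (-c) * k1 - d * k2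
  have hq' : q' = k * q := by
    simp only [q', q, qx]
    have k1' : (w.1 : ℝ) = k * v.1 := by exact_mod_cast k1
    have k2' : (w.2 : ℝ) = k * v.2 := by exact_mod_cast k2
    rw [k1', k2']; ring
  have hkpos : 0 < k := by
    have : (0 : ℝ) < k := by
      by_contra hc
      push Not at hc
      nlinarith
    exact_mod_cast this
  have hk1 : k = 1 := Int.eq_one_of_mul_eq_one_right hkpos.le hk
  rw [hk1, one_mul] at k1 k2
  exact (Prod.ext k1 k2).symm

lemma NG_le_one (Q R r1 r2 : ℝ) (hr : (r2 - r1) * R ^ 2 ≤ 1) (g : SL2R) :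
    NG Q R r1 r2 g ≤ 1 := by
  rw [NG_eq_encard]
  have := Set.encard_le_one_iff_subsingleton.2 (bset_subsing Q R r1 r2 hr g)
  exact_mod_cast this

/-- partition of a cone -/
lemma NG_split (Q R β : ℝ) (hβ : 0 < β) (J : ℕ) (hJ : 0 < J) (g : SL2R) :
    NG Q R 0 β g = ∑ j ∈ Finset.range J, NG Q R (j * (β / J)) (j * (β / J) + β / J) g := by
  unfold NG
  rw [← Summable.tsum_finsetSum (fun _ _ => ENNReal.summable)]
  refine tsum_congr fun v => ?_
  have hJ' : (0 : ℝ) < J := by exact_mod_cast hJ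
  set δ := β / J with hδ
  have hδ0 : 0 < δ := by positivity
  have hJδ : J * δ = β := by rw [hδ]; field_simp
  by_cases hv : v ∈ bset Q R 0 β g
  · obtain ⟨h0, h1, h2, h3, h4, h5⟩ := hv
    have hr0 : 0 ≤ px g v / (qx g v * δ) := by
      have : 0 ≤ px g v := by linarith
      positivity
    have hfl := Nat.floor_le hr0
    have hfl' := Nat.lt_floor_add_one (px g v / (qx g v * δ))
    set j0 := ⌊px g v / (qx g v * δ)⌋₊ with hj0
    have hmem : ∀ j : ℕ, v ∈ bset Q R (j * δ) (j * δ + δ) g ↔ j = j0 := by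
      intro j
      constructor
      · rintro ⟨-, -, -, -, k4, k5⟩
        rw [hj0]
        symm
        rw [Nat.floor_eq_iff hr0]
        constructor
        · rw [le_div_iff₀ (by positivity)]; linarith
        · rw [div_lt_iff₀ (by positivity)]; linarith
      · rintro rfl
        refine ⟨h0, h1, h2, h3, ?_, ?_⟩
        · rw [le_div_iff₀ (by positivity)] at hfl; linarith
        · rw [div_lt_iff₀ (by positivity)] at hfl'; linarith
    have hj0J : j0 < J := by
      have : (j0 : ℝ) < J := by
        rw [le_div_iff₀ (by positivity)] at hfl
        have h6 : (j0 : ℝ) * (qx g v * δ) < J * (qx g v * δ) := by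
          calc _ ≤ px g v := hfl
            _ < β * qx g v := h5
            _ = _ := by rw [← hJδ]; ring
        exact lt_of_mul_lt_mul_right h6 (by positivity)
      exact_mod_cast this
    rw [Set.indicator_of_mem (by exact ⟨h0, h1, h2, h3, h4, h5⟩), Finset.sum_eq_single j0]
    · rw [Set.indicator_of_mem ((hmem j0).2 rfl)]
    · intro j _ hj
      rw [Set.indicator_of_notMem]
      rw [hmem]; exact hj
    · intro h; exact absurd (Finset.mem_range.2 hj0J) h
  · rw [Set.indicator_of_notMem hv, Finset.sum_eq_zero]
    intro j hj
    rw [Set.indicator_of_notMem]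
    rintro ⟨h0, h1, h2, h3, h4, h5⟩
    apply hv
    refine ⟨h0, h1, h2, h3, ?_, ?_⟩
    · have : 0 ≤ (j : ℝ) * δ * qx g v := by positivity
      linarith
    · have hj' : ((j : ℝ) + 1) ≤ J := by exact_mod_cast Finset.mem_range.1 hj
      calc px g v < (j * δ + δ) * qx g v := h5
        _ = (j + 1) * (δ * qx g v) := by ring
        _ ≤ J * (δ * qx g v) := by gcongr
        _ = β * qx g v := by rw [← hJδ]; ring

lemma NG_bound (Q R β : ℝ) (hβ : 0 < β) (hR : 0 ≤ R) (g : SL2R) :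
    NG Q R 0 β g ≤ ENNReal.ofReal (β * R ^ 2 + 1) := by
  set J := ⌊β * R ^ 2⌋₊ + 1 with hJ
  have h0 : 0 ≤ β * R ^ 2 := by positivity
  have h1 : (J : ℝ) ≤ β * R ^ 2 + 1 := by
    rw [hJ]; push_cast; linarith [Nat.floor_le h0]
  have h2 : β * R ^ 2 < J := by rw [hJ]; push_cast; exact Nat.lt_floor_add_one _
  have hJ0 : (0 : ℝ) < J := h0.trans_lt h2
  rw [NG_split Q R β hβ J (Nat.succ_pos _)]
  calc _ ≤ ∑ j ∈ Finset.range J, (1 : ENNReal) := by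
        refine Finset.sum_le_sum fun j _ => NG_le_one _ _ _ _ ?_ _
        rw [add_sub_cancel_left, div_mul_eq_mul_div, div_le_one hJ0]; exact h2.le
    _ = ENNReal.ofReal J := by simp
    _ ≤ _ := ENNReal.ofReal_le_ofReal h1

lemma px_nSL (g : SL2R) (r : ℝ) (v) : px (g * nSL r) v = px g v + r * qx g v := by
  simp only [px, qx, mul00, mul10, nSL00, nSL10]; ring
lemma qx_nSL (g : SL2R) (r : ℝ) (v) : qx (g * nSL r) v = qx g v := by
  simp only [qx, mul01, mul11, nSL01, nSL11]; ring
lemma px_uSL (g : SL2R) (r : ℝ) (v) : px (g * uSL r) v = px g v := by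
  simp only [px, mul00, mul10, uSL00, uSL10]; ring
lemma qx_uSL (g : SL2R) (r : ℝ) (v) : qx (g * uSL r) v = qx g v + r * px g v := by
  simp only [px, qx, mul01, mul11, uSL01, uSL11]; ring

/-- shear -/
lemma NX_nSL (Q R r δ : ℝ) (x : XmodGamma) :
    NX Q R r (r + δ) (rmul (nSL r) x) = NX Q R 0 δ x := by
  obtain ⟨g, rfl⟩ := pj_surj x
  rw [rmul_pj, NX_pj, NX_pj, NG, NG]
  have : bset Q R r (r + δ) (g * nSL r) = bset Q R 0 δ g := by
    ext v
    simp only [bset, Bx, Set.mem_ofPred_eq, px_nSL, qx_nSL]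
    have e1 : r * qx g v ≤ px g v + r * qx g v ↔ 0 * qx g v ≤ px g v := by
      constructor <;> intro h <;> linarith
    have e2 : px g v + r * qx g v < (r + δ) * qx g v ↔ px g v < δ * qx g v := by
      constructor <;> intro h <;> linarith
    rw [e1, e2]
  rw [this]

lemma NX_uSL (Q a b δ s : ℝ) (hQ : 0 < Q) (ha : 0 < a) (hδ : 0 ≤ δ) (hs0 : 0 ≤ s) (hs : s ≤ Q ^ 2)
    (hab : a * (1 + Q ^ 2 * δ) ≤ b) (x : XmodGamma) :
    NX Q (a * Q) 0 δ (rmul (uSL (-s)) x) ≤ NX Q (b * Q) 0 δ x := by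
  obtain ⟨g, rfl⟩ := pj_surj x
  rw [rmul_pj, NX_pj, NX_pj, NG_eq_encard, NG_eq_encard]
  have : bset Q (a * Q) 0 δ (g * uSL (-s)) ⊆ bset Q (b * Q) 0 δ g := by
    rintro v ⟨h0, h1, h2, h3, h4, h5⟩
    rw [px_uSL, qx_uSL] at *
    set p := px g v
    set q := qx g v
    have hp : 0 ≤ p := by linarith
    have hsp : 0 ≤ s * p := by positivity
    have hsp' : s * p ≤ Q ^ 2 * (δ * (a * Q)) := by
      apply mul_le_mul hs _ hp (by positivity)
      exact h5.le.trans (by gcongr)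
    refine ⟨h0, by linarith, by linarith, ?_, by linarith, ?_⟩
    · have : a * (1 + Q ^ 2 * δ) * Q ≤ b * Q := by gcongr
      nlinarith
    · refine h5.trans_le ?_
      gcongr
      linarith
  have h := Set.encard_le_encard this
  exact_mod_cast h

lemma NX_prim (Q R β : ℝ) (hQR : Q ≤ R) (g : SL2R) :
    NX Q R 0 β (pj g) = ENNReal.ofReal ((primSet g β R).ncard - (primSet g β Q).ncard) := by
  have fin : ∀ S, (primSet g β S).Finite := fun S =>
    (allSet_fin g β S).subset fun v hv => hv.2
  have hsub : primSet g β Q ⊆ primSet g β R := fun v hv =>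
    ⟨hv.1, hv.2.1, hv.2.2.1.trans_le hQR, hv.2.2.2⟩
  have hb : bset Q R 0 β g = primSet g β R \ primSet g β Q := by
    ext v
    simp only [bset, Bx, primSet, inCone, Set.mem_diff, Set.mem_ofPred_eq, zero_mul]
    constructor
    · rintro ⟨h0, h1, h2, h3, h4, h5⟩
      exact ⟨⟨h0, h1, h3, h4, h5⟩, fun h => absurd h.2.2.1 (not_lt.2 h2)⟩
    · rintro ⟨⟨h0, h1, h3, h4, h5⟩, h⟩
      refine ⟨h0, h1, ?_, h3, h4, h5⟩
      by_contra hc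
      exact h ⟨h0, h1, not_le.1 hc, h4, h5⟩
  rw [NX_pj, NG_eq_encard, hb, ← ((fin R).diff).cast_ncard_eq, Set.ncard_diff hsub (fin Q)]
  rw [← Nat.cast_sub (Set.ncard_le_ncard hsub (fin R)), ENNReal.ofReal_natCast]
  rfl

lemma NX_tendsto (a β : ℝ) (ha : 1 ≤ a) (hβ : 0 < β) (x : XmodGamma) :
    Tendsto (fun Q : ℝ => NX Q (a * Q) 0 β x * ENNReal.ofReal (1 / Q ^ 2)) atTop
      (nhds (ENNReal.ofReal (mobC * coneV β * (a ^ 2 - 1)))) := by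
  obtain ⟨g, rfl⟩ := pj_surj x
  have h1 := prim_tendsto g β hβ
  have h2 := (h1.comp (tendsto_id.const_mul_atTop (by linarith : (0:ℝ) < a))).const_mul (a ^ 2)
  have h3 := h2.sub h1
  have e : a ^ 2 * (mobC * coneV β) - mobC * coneV β = mobC * coneV β * (a ^ 2 - 1) := by ring
  rw [e] at h3
  refine (ENNReal.tendsto_ofReal h3).congr' ?_
  filter_upwards [eventually_gt_atTop 0] with Q hQ
  rw [NX_prim Q (a * Q) β (by nlinarith), ← ENNReal.ofReal_mul']
  · congr 1
    simp only [Function.comp, id]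
    field_simp
  · positivity

/-- function along the closed horocycle -/
def hor (f : XmodGamma → ℝ) (t x : ℝ) : ℝ := f (pj (uSL x * aSL t))

/-- the horocycle average -/
def Hav (f : XmodGamma → ℝ) (t : ℝ) : ℝ := ∫ x in (0 : ℝ)..1, hor f t x

lemma hor_cont {f : XmodGamma → ℝ} (hf : Continuous f) (t : ℝ) : Continuous (hor f t) :=
  hf.comp (pj_cont.comp (uSL_cont.mul continuous_const))

lemma hor_per (f : XmodGamma → ℝ) (t : ℝ) : Function.Periodic (hor f t) 1 := by
  intro x
  have : uSL (x + 1) * aSL t = uSL ((1 : ℤ) : ℝ) * (uSL x * aSL t) := by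
    rw [← mul_assoc, ← uSL_add]; congr 2; push_cast; ring
  rw [hor, this, pj_uSL_int, hor]

lemma linv {μ : Measure XmodGamma} (hμ : ∀ h : SL2R, Measure.map (rmul h) μ = μ) (h : SL2R)
    {φ : XmodGamma → ENNReal} (hφ : Measurable φ) : ∫⁻ x, φ (rmul h x) ∂μ = ∫⁻ x, φ x ∂μ := by
  conv_rhs => rw [← hμ h]
  rw [lintegral_map hφ (rmul_cont h).measurable]

lemma decomp (g : SL2R) (hq : 0 < g.1 1 1) :
    g = uSL (g.1 0 1 / g.1 1 1) * aSL (2 * Real.log (g.1 1 1)) * nSL (g.1 1 0 / g.1 1 1) := by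
  have hd := det1 g
  have e1 : Real.exp (-(2 * Real.log (g.1 1 1) / 2)) = (g.1 1 1)⁻¹ := by
    rw [mul_div_cancel_left₀ _ (two_ne_zero), Real.exp_neg, Real.exp_log hq]
  have e2 : Real.exp (2 * Real.log (g.1 1 1) / 2) = g.1 1 1 := by
    rw [mul_div_cancel_left₀ _ (two_ne_zero), Real.exp_log hq]
  apply sl_ext <;> simp only [mul00, mul01, mul10, mul11, uSL00, uSL01, uSL10, uSL11, aSL00,
    aSL01, aSL10, aSL11, nSL00, nSL01, nSL10, nSL11, e1, e2] <;> field_simp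
  · linear_combination hd
  · ring
  · simp
  · ring

lemma local_est (f : XmodGamma → ℝ) (hf : Continuous f) (hf0 : ∀ x, 0 ≤ f x)
    (e η : ℝ) (hη : ∀ h, near1 η h → ∀ g, |f (pj (g * h)) - f (pj g)| ≤ e)
    (Q b δ : ℝ) (hQ : 0 < Q) (hb : 1 < b) (hbη : b - 1 < η) (hδ : 0 < δ)
    (hδη : δ * (1 + Q ^ 2 + Q ^ 4) < η) (g : SL2R) (hg : Bx Q (b * Q) 0 δ (g.1 1 0) (g.1 1 1)) :
    ∫ s in (0 : ℝ)..Q ^ 2, f (pj (g * uSL (-s))) ≤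
      Q ^ 2 * (b ^ 2 * Hav f (2 * Real.log Q) + 2 * e) := by
  obtain ⟨hq0, hq1, hq2, hp1, hp2⟩ := hg
  have hdec := decomp g hq0
  set q := g.1 1 1 with hq
  set p := g.1 1 0 with hp
  set x0 := g.1 0 1 / q
  set r := p / q with hr
  set t0 := 2 * Real.log Q
  have hη0 : 0 < η := by linarith
  have hr0 : 0 ≤ r := by apply div_nonneg _ hq0.le; linarith
  have hrδ : r < δ := by rw [hr, div_lt_iff₀ hq0]; exact hp2
  set τ := 2 * Real.log (q / Q) with hτ
  have haq : aSL (2 * Real.log q) = aSL t0 * aSL τ := by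
    rw [← aSL_add]; congr 1
    rw [hτ, Real.log_div hq0.ne' hQ.ne']; ring
  have hτ1 : Real.exp (τ / 2) = q / Q := by
    rw [hτ, mul_div_cancel_left₀ _ (two_ne_zero), Real.exp_log (by positivity)]
  have hτ2 : Real.exp (-(τ / 2)) = Q / q := by
    rw [Real.exp_neg, hτ1, inv_div]
  have hnear1 : near1 η (aSL τ) := by
    simp only [near1, aSL00, aSL01, aSL10, aSL11, hτ1, hτ2, abs_zero]
    have a1 : q / Q < b := by rw [div_lt_iff₀ hQ]; exact hq2
    have a2 : 1 ≤ q / Q := by rw [one_le_div hQ]; exact hq1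
    have a3 : Q / q ≤ 1 := by rw [div_le_one hq0]; exact hq1
    have a4 : 1 - Q / q ≤ q / Q - 1 := by
      have : (Q / q) * (q / Q) = 1 := by field_simp
      nlinarith
    refine ⟨?_, hη0, hη0, ?_⟩ <;> rw [abs_lt] <;> constructor <;> linarith
  have hpt : ∀ s, 0 ≤ s → s ≤ Q ^ 2 → f (pj (g * uSL (-s))) ≤ hor f t0 (x0 - s / q ^ 2) + 2 * e := by
    intro s hs0 hs1
    have hfac : g * uSL (-s) = (uSL (x0 - s / q ^ 2) * aSL t0) * aSL τ * (uSL s * nSL r * uSL (-s)) := by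
      have h1 : uSL (x0 - s / q ^ 2) * aSL t0 * aSL τ = uSL x0 * aSL (2 * Real.log q) * uSL (-s) := by
        rw [mul_assoc, ← haq, uSL_aSL_uSL]
        congr 2
        have : Real.exp (-(2 * Real.log q)) = 1 / q ^ 2 := by
          rw [Real.exp_neg, two_mul, Real.exp_add, Real.exp_log hq0]; field_simp
        rw [this]; ring
      have h2 : uSL (-s) * uSL s = 1 := by
        rw [← uSL_add]; apply sl_ext <;> simp
      rw [h1]
      calc g * uSL (-s) = uSL x0 * aSL (2 * Real.log q) * nSL r * uSL (-s) := by rw [← hdec]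
        _ = uSL x0 * aSL (2 * Real.log q) * (uSL (-s) * uSL s) * nSL r * uSL (-s) := by
          rw [h2, mul_one]
        _ = _ := by simp only [mul_assoc]
    have hnear2 : near1 η (uSL s * nSL r * uSL (-s)) := by
      simp only [near1, mul00, mul01, mul10, mul11, uSL00, uSL01, uSL10, uSL11, nSL00, nSL01,
        nSL10, nSL11]
      have b1 : s * r ≤ Q ^ 2 * δ := mul_le_mul hs1 hrδ.le hr0 (by positivity)
      have b2 : s * (s * r) ≤ Q ^ 2 * (Q ^ 2 * δ) :=
        mul_le_mul hs1 b1 (by positivity) (by positivity)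
      have b3 : 0 ≤ s * r := by positivity
      have b4 : 0 ≤ s * (s * r) := by positivity
      have b5 : 0 ≤ Q ^ 2 * δ := by positivity
      have b6 : 0 ≤ Q ^ 2 * (Q ^ 2 * δ) := by positivity
      refine ⟨?_, ?_, ?_, ?_⟩ <;> rw [abs_lt] <;> constructor <;> nlinarith
    have i1 := hη _ hnear2 ((uSL (x0 - s / q ^ 2) * aSL t0) * aSL τ)
    have i2 := hη _ hnear1 (uSL (x0 - s / q ^ 2) * aSL t0)
    rw [← hfac] at i1
    rw [hor]
    linarith [(abs_le.1 i1).2, (abs_le.1 i2).2]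
  have hc := hor_cont hf t0
  have hc1 : Continuous fun s : ℝ => hor f t0 (x0 - s / q ^ 2) := by fun_prop
  have hnn : ∀ x, 0 ≤ hor f t0 x := fun x => hf0 _
  have hQ2 : 0 ≤ Q ^ 2 := by positivity
  have hq20 : 0 < q ^ 2 := by positivity
  have hqQ : Q ^ 2 / q ^ 2 ≤ 1 := by
    rw [div_le_one hq20]; gcongr
  have hH : ∫ x in (x0 - Q ^ 2 / q ^ 2)..x0, hor f t0 x ≤ Hav f t0 := by
    have := (hor_per f t0).intervalIntegral_add_eq (x0 - 1) 0
    rw [sub_add_cancel, zero_add] at this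
    rw [Hav, ← this]
    apply intervalIntegral.integral_mono_interval (by linarith) _ le_rfl
    · exact Eventually.of_forall hnn
    · exact hc.intervalIntegrable _ _
    · have : 0 ≤ Q ^ 2 / q ^ 2 := by positivity
      linarith
  have hH0 : 0 ≤ Hav f t0 := intervalIntegral.integral_nonneg (by norm_num) fun x _ => hnn x
  have hcu : Continuous fun s : ℝ => f (pj (g * uSL (-s))) :=
    hf.comp (pj_cont.comp (continuous_const.mul (uSL_cont.comp continuous_neg)))
  calc ∫ s in (0 : ℝ)..Q ^ 2, f (pj (g * uSL (-s)))
      ≤ ∫ s in (0 : ℝ)..Q ^ 2, (hor f t0 (x0 - s / q ^ 2) + 2 * e) := by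
        refine intervalIntegral.integral_mono_on hQ2 (hcu.intervalIntegrable _ _)
          ((hc1.add continuous_const).intervalIntegrable _ _) fun s hs => hpt s hs.1 hs.2
    _ = q ^ 2 * (∫ x in (x0 - Q ^ 2 / q ^ 2)..x0, hor f t0 x) + Q ^ 2 * (2 * e) := by
        rw [intervalIntegral.integral_add (hc1.intervalIntegrable _ _)
          (continuous_const.intervalIntegrable _ _)]
        rw [intervalIntegral.integral_comp_sub_div (fun x => hor f t0 x) hq20.ne']
        simp
        ring
    _ ≤ (b * Q) ^ 2 * Hav f t0 + Q ^ 2 * (2 * e) := by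
        have : q ^ 2 ≤ (b * Q) ^ 2 := by gcongr
        have := mul_le_mul this hH (intervalIntegral.integral_nonneg (by
          have : 0 ≤ Q ^ 2 / q ^ 2 := by positivity
          linarith) fun x _ => hnn x) (by positivity)
        linarith
    _ = _ := by ring

set_option maxHeartbeats 1000000 in
lemma key_ineq (μ : Measure XmodGamma) [IsProbabilityMeasure μ]
    (hμ : ∀ h : SL2R, Measure.map (rmul h) μ = μ)
    (f : XmodGamma → ℝ) (hf : Continuous f) (hf0 : ∀ x, 0 ≤ f x)
    (e η : ℝ) (he : 0 < e) (hη : ∀ h, near1 η h → ∀ g, |f (pj (g * h)) - f (pj g)| ≤ e)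
    (Q a b β : ℝ) (hQ : 0 < Q) (ha : 1 < a) (hab : a < b) (hbη : b - 1 < η) (hβ : 0 < β)
    (hβη : β < η) :
    ∫⁻ x, ENNReal.ofReal (f x) * NX Q (a * Q) 0 β x ∂μ ≤
      ENNReal.ofReal (b ^ 2 * Hav f (2 * Real.log Q) + 3 * e) * ∫⁻ x, NX Q (b * Q) 0 β x ∂μ := by
  have hη0 : 0 < η := by linarith
  set t0 := 2 * Real.log Q
  -- choose J
  obtain ⟨J, hJ0, hJ1, hJ2⟩ : ∃ J : ℕ, 0 < J ∧ a * (1 + Q ^ 2 * (β / J)) ≤ b ∧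
      (β / J) * (1 + Q ^ 2 + Q ^ 4) < η := by
    have h0 : Tendsto (fun J : ℕ => β / (J : ℝ)) atTop (nhds 0) :=
      tendsto_const_div_atTop_nhds_zero_nat β
    have h1 : Tendsto (fun J : ℕ => a * (1 + Q ^ 2 * (β / (J : ℝ)))) atTop (nhds (a * (1 + Q ^ 2 * 0))) :=
      ((h0.const_mul _).const_add _).const_mul _
    have h2 := h0.mul_const (1 + Q ^ 2 + Q ^ 4)
    have := ((eventually_gt_atTop 0).and ((h1.eventually_le_const (u := b) (by simpa using hab)).and
      (h2.eventually_lt_const (u := η) (by simpa using hη0)))).exists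
    obtain ⟨J, h⟩ := this
    exact ⟨J, h⟩
  have hJ' : (0 : ℝ) < J := by exact_mod_cast hJ0
  set δ := β / J with hδ
  have hδ0 : 0 < δ := by positivity
  have hFm : Measurable fun x => ENNReal.ofReal (f x) := hf.measurable.ennreal_ofReal
  have hFN : ∀ R r1 r2, Measurable fun x => ENNReal.ofReal (f x) * NX Q R r1 r2 x :=
    fun R r1 r2 => hFm.mul (NX_meas _ _ _ _)
  have hsplit : ∀ R x, NX Q R 0 β x = ∑ j ∈ Finset.range J, NX Q R (j * δ) (j * δ + δ) x := by
    intro R x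
    obtain ⟨g, rfl⟩ := pj_surj x
    simp only [NX_pj]
    exact NG_split Q R β hβ J hJ0 g
  have hb1 : 1 < b := ha.trans hab
  -- total of N^+
  have hplus : ∫⁻ x, NX Q (b * Q) 0 β x ∂μ = J * ∫⁻ x, NX Q (b * Q) 0 δ x ∂μ := by
    simp_rw [hsplit]
    rw [lintegral_finsetSum _ fun j _ => NX_meas _ _ _ _]
    rw [Finset.sum_congr rfl (g := fun _ => ∫⁻ x, NX Q (b * Q) 0 δ x ∂μ)]
    · simp
    · intro j _
      rw [← linv hμ (nSL (j * δ)) (NX_meas _ _ _ _)]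
      simp_rw [NX_nSL]
  -- narrow piece
  have hH0 : 0 ≤ Hav f t0 := intervalIntegral.integral_nonneg (by norm_num) fun x _ => hf0 _
  have hQ2 : 0 < Q ^ 2 := by positivity
  have hnarrow : ∫⁻ x, ENNReal.ofReal (f x) * NX Q (a * Q) 0 δ x ∂μ ≤
      ENNReal.ofReal (b ^ 2 * Hav f t0 + 2 * e) * ∫⁻ x, NX Q (b * Q) 0 δ x ∂μ := by
    set I := ∫⁻ x, ENNReal.ofReal (f x) * NX Q (a * Q) 0 δ x ∂μ
    have hstep : ∀ s ∈ Set.Ioc 0 (Q ^ 2), I ≤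
        ∫⁻ x, ENNReal.ofReal (f (rmul (uSL (-s)) x)) * NX Q (b * Q) 0 δ x ∂μ := by
      intro s hs
      have : I = ∫⁻ x, ENNReal.ofReal (f (rmul (uSL (-s)) x)) *
          NX Q (a * Q) 0 δ (rmul (uSL (-s)) x) ∂μ :=
        (linv hμ (uSL (-s)) (hFN _ _ _)).symm
      rw [this]
      refine lintegral_mono fun x => ?_
      exact mul_le_mul_right (NX_uSL Q a b δ s hQ (by linarith) hδ0.le hs.1.le hs.2 hJ1 x) _
    have hcont : Continuous fun p : ℝ × XmodGamma => f (rmul (uSL (-p.1)) p.2) :=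
      hf.comp (rmul_cont₂.comp (continuous_snd.prodMk (uSL_cont.comp continuous_fst.neg)))
    have h1 : ENNReal.ofReal (Q ^ 2) * I ≤ ∫⁻ s in Set.Ioc 0 (Q ^ 2),
        ∫⁻ x, ENNReal.ofReal (f (rmul (uSL (-s)) x)) * NX Q (b * Q) 0 δ x ∂μ := by
      calc ENNReal.ofReal (Q ^ 2) * I = ∫⁻ s in Set.Ioc 0 (Q ^ 2), I := by
            rw [setLIntegral_const, Real.volume_Ioc, sub_zero, mul_comm]
        _ ≤ _ := setLIntegral_mono' measurableSet_Ioc hstep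
    have hsw := lintegral_lintegral_swap (μ := volume.restrict (Set.Ioc 0 (Q ^ 2))) (ν := μ)
      (f := fun s x => ENNReal.ofReal (f (rmul (uSL (-s)) x)) * NX Q (b * Q) 0 δ x)
      (Measurable.aemeasurable
        (hcont.measurable.ennreal_ofReal.mul ((NX_meas _ _ _ _).comp measurable_snd)))
    rw [hsw] at h1
    · have h2 : ∀ x, (∫⁻ s in Set.Ioc 0 (Q ^ 2), ENNReal.ofReal (f (rmul (uSL (-s)) x)) *
          NX Q (b * Q) 0 δ x) ≤ ENNReal.ofReal (Q ^ 2) * (ENNReal.ofReal (b ^ 2 * Hav f t0 + 2 * e)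
            * NX Q (b * Q) 0 δ x) := by
        intro x
        have hcx : Continuous fun s : ℝ => f (rmul (uSL (-s)) x) :=
          hcont.comp (continuous_id.prodMk continuous_const)
        rw [lintegral_mul_const _ hcx.measurable.ennreal_ofReal, ← mul_assoc]
        by_cases hx : NX Q (b * Q) 0 δ x = 0
        · rw [hx]; simp
        obtain ⟨g, rfl, hg⟩ := NX_rep _ _ _ _ _ hx
        refine mul_le_mul_left ?_ _
        rw [← ENNReal.ofReal_mul hQ2.le]
        have h3 := local_est f hf hf0 e η hη Q b δ hQ hb1 hbη hδ0 hJ2 g hg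
        rw [← ofReal_integral_eq_lintegral_ofReal]
        · rw [← intervalIntegral.integral_of_le hQ2.le]
          exact ENNReal.ofReal_le_ofReal h3
        · exact (hcx.intervalIntegrable 0 (Q ^ 2)).1
        · exact Eventually.of_forall fun s => hf0 _
      have h4 := h1.trans (lintegral_mono h2)
      rw [lintegral_const_mul _ ((NX_meas _ _ _ _).const_mul _),
        lintegral_const_mul _ (NX_meas _ _ _ _)] at h4
      rwa [ENNReal.mul_le_mul_iff_right] at h4
      · simpa using hQ.ne'
      · exact ENNReal.ofReal_ne_top
  have hj : ∀ j ∈ Finset.range J, ∫⁻ x, ENNReal.ofReal (f x) * NX Q (a * Q) (j * δ) (j * δ + δ) x ∂μ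
      ≤ ENNReal.ofReal (b ^ 2 * Hav f t0 + 3 * e) * ∫⁻ x, NX Q (b * Q) 0 δ x ∂μ := by
    intro j hj
    have hjJ : (j : ℝ) < J := by exact_mod_cast Finset.mem_range.1 hj
    have hjδ : j * δ < η := by
      calc j * δ ≤ J * δ := by gcongr
        _ = β := by rw [hδ]; field_simp
        _ < η := hβη
    have hjδ0 : 0 ≤ j * δ := by positivity
    have hnear : near1 η (nSL (j * δ)) := by
      simp only [near1, nSL00, nSL01, nSL10, nSL11, sub_self, abs_zero, abs_of_nonneg hjδ0]
      exact ⟨hη0, hη0, hjδ, hη0⟩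
    rw [← linv hμ (nSL (j * δ)) (hFN _ _ _)]
    simp_rw [NX_nSL]
    calc ∫⁻ x, ENNReal.ofReal (f (rmul (nSL (j * δ)) x)) * NX Q (a * Q) 0 δ x ∂μ
        ≤ ∫⁻ x, (ENNReal.ofReal (f x) * NX Q (a * Q) 0 δ x
            + ENNReal.ofReal e * NX Q (a * Q) 0 δ x) ∂μ := by
          refine lintegral_mono fun x => ?_
          obtain ⟨g, rfl⟩ := pj_surj x
          simp only
          rw [← add_mul, ← ENNReal.ofReal_add (hf0 _) he.le]
          refine mul_le_mul_left (ENNReal.ofReal_le_ofReal ?_) _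
          have := (abs_le.1 (hη _ hnear g)).2
          rw [rmul_pj]; linarith
      _ = (∫⁻ x, ENNReal.ofReal (f x) * NX Q (a * Q) 0 δ x ∂μ)
            + ENNReal.ofReal e * ∫⁻ x, NX Q (a * Q) 0 δ x ∂μ := by
          rw [lintegral_add_left (hFN _ _ _), lintegral_const_mul _ (NX_meas _ _ _ _)]
      _ ≤ ENNReal.ofReal (b ^ 2 * Hav f t0 + 2 * e) * (∫⁻ x, NX Q (b * Q) 0 δ x ∂μ)
            + ENNReal.ofReal e * ∫⁻ x, NX Q (b * Q) 0 δ x ∂μ := by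
          refine add_le_add hnarrow (mul_le_mul_right (lintegral_mono fun x => ?_) _)
          have := NX_uSL Q a b δ 0 hQ (by linarith) hδ0.le le_rfl hQ2.le hJ1 x
          rwa [show rmul (uSL (-0)) x = x by
            rw [show uSL (-0) = 1 by apply sl_ext <;> simp]; exact rmul_one x] at this
      _ = _ := by
          rw [← add_mul, ← ENNReal.ofReal_add (by positivity) he.le]
          congr 2; ring
  calc ∫⁻ x, ENNReal.ofReal (f x) * NX Q (a * Q) 0 β x ∂μ
      = ∑ j ∈ Finset.range J, ∫⁻ x, ENNReal.ofReal (f x) * NX Q (a * Q) (j * δ) (j * δ + δ) x ∂μ := by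
        simp_rw [hsplit, Finset.mul_sum]
        rw [lintegral_finsetSum _ fun j _ => hFN _ _ _]
    _ ≤ ∑ j ∈ Finset.range J,
        ENNReal.ofReal (b ^ 2 * Hav f t0 + 3 * e) * ∫⁻ x, NX Q (b * Q) 0 δ x ∂μ :=
        Finset.sum_le_sum hj
    _ = _ := by
        rw [hplus, Finset.sum_const, Finset.card_range, nsmul_eq_mul]; ring

set_option maxHeartbeats 1000000 in
lemma horo_lower (μ : Measure XmodGamma) [IsProbabilityMeasure μ]
    (hμ : ∀ h : SL2R, Measure.map (rmul h) μ = μ)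
    (f : XmodGamma → ℝ) (hf : Continuous f) (hf0 : ∀ x, 0 ≤ f x) (C : ℝ) (hfC : ∀ x, f x ≤ C)
    (hruc : RUC f) (e : ℝ) (he : 0 < e) :
    ∀ᶠ t in atTop, ∫ x, f x ∂μ ≤ Hav f t + e := by
  have hC0 : 0 ≤ C := (hf0 (pj 1)).trans (hfC _)
  set e1 := e / 7 with he1
  have he10 : 0 < e1 := by positivity
  obtain ⟨η, hη0, hη⟩ := hruc e1 he10
  set M := ∫ x, f x ∂μ with hM
  have hfi : Integrable f μ := Integrable.of_bound hf.measurable.aestronglyMeasurable C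
    (Eventually.of_forall fun x => by rw [Real.norm_eq_abs, abs_of_nonneg (hf0 x)]; exact hfC x)
  have hM0 : 0 ≤ M := integral_nonneg hf0
  have hMC : M ≤ C := by
    have := integral_mono hfi (integrable_const C) hfC
    simpa using this
  -- choose b
  obtain ⟨b, hb1, hbη, hbC⟩ : ∃ b : ℝ, 1 < b ∧ b - 1 < η ∧ (b ^ 2 - 1) * C < e1 := by
    have h1 : ∀ᶠ b : ℝ in nhdsWithin 1 (Set.Ioi 1), b - 1 < η := by
      apply nhdsWithin_le_nhds
      apply ContinuousAt.eventually_lt (by fun_prop) (by fun_prop); simpa using hη0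
    have h2 : ∀ᶠ b : ℝ in nhdsWithin 1 (Set.Ioi 1), (b ^ 2 - 1) * C < e1 := by
      apply nhdsWithin_le_nhds
      apply ContinuousAt.eventually_lt (by fun_prop) (by fun_prop); simpa using he10
    obtain ⟨b, h⟩ := ((eventually_mem_nhdsWithin).and (h1.and h2)).exists
    exact ⟨b, h⟩
  have hb2 : 0 < b ^ 2 - 1 := by nlinarith
  obtain ⟨a, hab, ha1, haC⟩ : ∃ a : ℝ, a < b ∧ 1 < a ∧ M * (1 - (a ^ 2 - 1) / (b ^ 2 - 1)) < e1 := by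
    have h1 : ∀ᶠ a : ℝ in nhdsWithin b (Set.Iio b), 1 < a := by
      apply nhdsWithin_le_nhds
      exact eventually_gt_nhds hb1
    have h2 : ∀ᶠ a : ℝ in nhdsWithin b (Set.Iio b),
        M * (1 - (a ^ 2 - 1) / (b ^ 2 - 1)) < e1 := by
      apply nhdsWithin_le_nhds
      apply ContinuousAt.eventually_lt (by fun_prop) (by fun_prop)
      rw [div_self hb2.ne']; simpa using he10
    obtain ⟨a, h⟩ := ((eventually_mem_nhdsWithin).and (h1.and h2)).exists
    exact ⟨a, h⟩
  set β := η / 2 with hβ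
  have hβ0 : 0 < β := by positivity
  set c := mobC * coneV β with hc
  have hc0 : 0 < c := mul_pos mobC_pos (coneV_pos β hβ0)
  have hFm : Measurable fun x => ENNReal.ofReal (f x) := hf.measurable.ennreal_ofReal
  -- bounds
  have hbd : ∀ a' : ℝ, 0 ≤ a' → ∀ Q : ℝ, 1 ≤ Q → ∀ x, NX Q (a' * Q) 0 β x * ENNReal.ofReal (1 / Q ^ 2)
      ≤ ENNReal.ofReal (β * a' ^ 2 + 1) := by
    intro a' ha' Q hQ x
    obtain ⟨g, rfl⟩ := pj_surj x
    rw [NX_pj]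
    refine (mul_le_mul_left (NG_bound Q (a' * Q) β hβ0 (by positivity) g) _).trans ?_
    rw [← ENNReal.ofReal_mul (by positivity)]
    apply ENNReal.ofReal_le_ofReal
    have hQ2 : 1 ≤ Q ^ 2 := one_le_pow₀ hQ
    rw [mul_one_div, div_le_iff₀ (by positivity)]
    nlinarith
  have hU : Tendsto (fun Q : ℝ => ∫⁻ x, NX Q (b * Q) 0 β x * ENNReal.ofReal (1 / Q ^ 2) ∂μ) atTop
      (nhds (∫⁻ x, ENNReal.ofReal (c * (b ^ 2 - 1)) ∂μ)) := by
    refine tendsto_lintegral_filter_of_dominated_convergence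
      (fun _ => ENNReal.ofReal (β * b ^ 2 + 1)) ?_ ?_ ?_ ?_
    · exact Eventually.of_forall fun Q => (NX_meas _ _ _ _).mul_const _
    · filter_upwards [eventually_ge_atTop 1] with Q hQ
      exact Eventually.of_forall fun x => hbd b (by linarith) Q hQ x
    · simp
    · exact Eventually.of_forall fun x => NX_tendsto b β hb1.le hβ0 x
  have hL : Tendsto (fun Q : ℝ => ∫⁻ x, ENNReal.ofReal (f x) * (NX Q (a * Q) 0 β x *
      ENNReal.ofReal (1 / Q ^ 2)) ∂μ) atTop
      (nhds (∫⁻ x, ENNReal.ofReal (f x) * ENNReal.ofReal (c * (a ^ 2 - 1)) ∂μ)) := by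
    refine tendsto_lintegral_filter_of_dominated_convergence
      (fun _ => ENNReal.ofReal C * ENNReal.ofReal (β * a ^ 2 + 1)) ?_ ?_ ?_ ?_
    · exact Eventually.of_forall fun Q => hFm.mul ((NX_meas _ _ _ _).mul_const _)
    · filter_upwards [eventually_ge_atTop 1] with Q hQ
      exact Eventually.of_forall fun x => mul_le_mul' (ENNReal.ofReal_le_ofReal (hfC x))
        (hbd a (by linarith) Q hQ x)
    · simp [ENNReal.mul_eq_top]
    · exact Eventually.of_forall fun x =>
        ENNReal.Tendsto.const_mul (NX_tendsto a β ha1.le hβ0 x) (Or.inr ENNReal.ofReal_ne_top)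
  have eU : ∫⁻ x, ENNReal.ofReal (c * (b ^ 2 - 1)) ∂μ = ENNReal.ofReal (c * (b ^ 2 - 1)) := by simp
  have eL : ∫⁻ x, ENNReal.ofReal (f x) * ENNReal.ofReal (c * (a ^ 2 - 1)) ∂μ
      = ENNReal.ofReal (M * (c * (a ^ 2 - 1))) := by
    rw [lintegral_mul_const _ hFm, ← ofReal_integral_eq_lintegral_ofReal hfi
      (Eventually.of_forall hf0), ← ENNReal.ofReal_mul hM0]
  rw [eU] at hU
  rw [eL] at hL
  have hU' := (ENNReal.tendsto_toReal ENNReal.ofReal_ne_top).comp hU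
  have hL' := (ENNReal.tendsto_toReal ENNReal.ofReal_ne_top).comp hL
  have ha2 : 0 < a ^ 2 - 1 := by nlinarith
  rw [ENNReal.toReal_ofReal (by positivity)] at hU' hL'
  set cb := c * (b ^ 2 - 1) with hcb
  have hcb0 : 0 < cb := by positivity
  have hexp : Tendsto (fun t : ℝ => Real.exp (t / 2)) atTop atTop :=
    Real.tendsto_exp_atTop.comp (tendsto_id.atTop_div_const (by norm_num))
  set Km := b ^ 2 * C + 3 * e1 + 1 with hKm
  have hKm0 : 0 < Km := by positivity
  have ev1 : ∀ᶠ t : ℝ in atTop, _ := hexp.eventually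
    (hU'.eventually_lt_const (u := cb * (1 + e1 / Km)) (by
      have : 0 < cb * (e1 / Km) := by positivity
      linarith))
  have ev2 : ∀ᶠ t : ℝ in atTop, _ := hexp.eventually
    (hL'.eventually_const_lt (u := M * (c * (a ^ 2 - 1)) - cb * e1) (by
      have : 0 < cb * e1 := by positivity
      linarith))
  have ev3 : ∀ᶠ t : ℝ in atTop, _ := hexp.eventually (hU.eventually_lt_const ENNReal.ofReal_lt_top)
  filter_upwards [ev1, ev2, ev3] with t h1 h2 h3
  set Q := Real.exp (t / 2) with hQ
  have hQ0 : 0 < Q := Real.exp_pos _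
  have hQt : 2 * Real.log Q = t := by rw [hQ, Real.log_exp]; ring
  have hkey := key_ineq μ hμ f hf hf0 e1 η he10 hη Q a b β hQ0 ha1 hab hbη hβ0 (by rw [hβ]; linarith)
  rw [hQt] at hkey
  have hH0 : 0 ≤ Hav f t := intervalIntegral.integral_nonneg (by norm_num) fun x _ => hf0 _
  have hHC : Hav f t ≤ C := by
    have := intervalIntegral.integral_mono_on (μ := volume) (a := 0) (b := 1) (by norm_num)
      ((hor_cont hf t).intervalIntegrable 0 1) (continuous_const.intervalIntegrable 0 1)
      (fun x _ => (hfC _ : hor f t x ≤ C))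
    simp at this
    exact this
  set K := b ^ 2 * Hav f t + 3 * e1 with hK
  have hK0 : 0 ≤ K := by positivity
  have hKKm : K ≤ Km := by
    have : b ^ 2 * Hav f t ≤ b ^ 2 * C := by gcongr
    linarith
  simp only [Function.comp] at h1 h2
  have hk2 : (∫⁻ x, ENNReal.ofReal (f x) * (NX Q (a * Q) 0 β x * ENNReal.ofReal (1 / Q ^ 2)) ∂μ)
      ≤ ENNReal.ofReal K * ∫⁻ x, NX Q (b * Q) 0 β x * ENNReal.ofReal (1 / Q ^ 2) ∂μ := by
    simp_rw [← mul_assoc]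
    have hFN : Measurable fun x => ENNReal.ofReal (f x) * NX Q (a * Q) 0 β x :=
      hFm.mul (NX_meas _ _ _ _)
    rw [lintegral_mul_const _ hFN, lintegral_mul_const _ (NX_meas _ _ _ _),
      ← mul_assoc]
    exact mul_le_mul_left hkey _
  have hk3 := ENNReal.toReal_mono (ENNReal.mul_ne_top ENNReal.ofReal_ne_top h3.ne) hk2
  rw [ENNReal.toReal_mul, ENNReal.toReal_ofReal hK0] at hk3
  set u := (∫⁻ x, NX Q (b * Q) 0 β x * ENNReal.ofReal (1 / Q ^ 2) ∂μ).toReal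
  have hk4 : K * u ≤ K * (cb * (1 + e1 / Km)) := by gcongr
  have hk5 : K * (e1 / Km) ≤ e1 := by
    rw [mul_div_assoc', div_le_iff₀ hKm0]; nlinarith
  have hk6 : M * (c * (a ^ 2 - 1)) - cb * e1 ≤ cb * (K + e1) := by
    have : cb * (K * (e1 / Km)) ≤ cb * e1 := by gcongr
    nlinarith
  have hk7 : M * ((a ^ 2 - 1) / (b ^ 2 - 1)) ≤ K + 2 * e1 := by
    have : M * (c * (a ^ 2 - 1)) = cb * (M * ((a ^ 2 - 1) / (b ^ 2 - 1))) := by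
      rw [hcb]; field_simp
    rw [this] at hk6
    have : cb * (M * ((a ^ 2 - 1) / (b ^ 2 - 1))) ≤ cb * (K + 2 * e1) := by linarith
    exact le_of_mul_le_mul_left this hcb0
  have hk8 : (b ^ 2 - 1) * Hav f t ≤ (b ^ 2 - 1) * C := by gcongr
  have : e = 7 * e1 := by rw [he1]; ring
  rw [this]
  nlinarith

lemma ruc_const_sub {f : XmodGamma → ℝ} (h : RUC f) (C : ℝ) : RUC fun x => C - f x := by
  intro e he
  obtain ⟨δ, h0, h1⟩ := h e he
  refine ⟨δ, h0, fun k hk g => ?_⟩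
  rw [sub_sub_sub_cancel_left, abs_sub_comm]; exact h1 k hk g

lemma horo_upper (μ : Measure XmodGamma) [IsProbabilityMeasure μ]
    (hμ : ∀ h : SL2R, Measure.map (rmul h) μ = μ)
    (f : XmodGamma → ℝ) (hf : Continuous f) (hf0 : ∀ x, 0 ≤ f x) (C : ℝ) (hfC : ∀ x, f x ≤ C)
    (hruc : RUC f) (e : ℝ) (he : 0 < e) :
    ∀ᶠ t in atTop, Hav f t ≤ ∫ x, f x ∂μ + e := by
  have hfi : Integrable f μ := Integrable.of_bound hf.measurable.aestronglyMeasurable C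
    (Eventually.of_forall fun x => by rw [Real.norm_eq_abs, abs_of_nonneg (hf0 x)]; exact hfC x)
  filter_upwards [horo_lower μ hμ (fun x => C - f x) (continuous_const.sub hf)
    (fun x => sub_nonneg.2 (hfC x)) C (fun x => by linarith [hf0 x]) (ruc_const_sub hruc C) e he]
    with t ht
  rw [integral_sub (integrable_const C) hfi] at ht
  have : Hav (fun x => C - f x) t = C - Hav f t := by
    have h := intervalIntegral.integral_sub (μ := volume) (a := 0) (b := 1)
      (continuous_const.intervalIntegrable 0 1 : IntervalIntegrable (fun _ : ℝ => C) volume 0 1)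
      ((hor_cont hf t).intervalIntegrable 0 1)
    simp at h
    exact h
  rw [this] at ht
  simp at ht
  linarith

lemma periodic_shift (m : ℕ) (h : ℤ → ℝ) (hp : ∀ j, h (j + m) = h j) (k : ℤ) :
    ∑ i ∈ Finset.range m, h (k + i) = ∑ i ∈ Finset.range m, h i := by
  have step : ∀ k : ℤ, ∑ i ∈ Finset.range m, h (k + 1 + i) = ∑ i ∈ Finset.range m, h (k + i) := by
    intro k
    have h1 := Finset.sum_range_succ (fun i : ℕ => h (k + i)) m
    have h2 := Finset.sum_range_succ' (fun i : ℕ => h (k + i)) m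
    rw [h1] at h2
    have h3 : ∀ i : ℕ, h (k + ((i + 1 : ℕ) : ℤ)) = h (k + 1 + i) := by
      intro i; congr 1; push_cast; ring
    simp only [h3, hp, Nat.cast_zero, add_zero] at h2
    linarith
  induction k using Int.induction_on with
  | zero => simp
  | succ k ih => rw [step, ih]
  | pred k ih =>
    rw [← ih, ← step]; simp

/-- coprime residues -/
abbrev Lam (m : ℕ) : Finset ℕ := (Finset.Icc 1 m).filter (fun ℓ => Nat.gcd ℓ m = 1)

lemma Lam_card (m : ℕ) : (Lam m).card = m.totient := by
  rw [← Nat.filter_coprime_Ico_eq_totient m 1]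
  refine congrArg Finset.card ?_
  ext x
  simp only [Finset.mem_filter, Finset.mem_Icc, Finset.mem_Ico, Nat.Coprime, Nat.gcd_comm m x]
  constructor
  · rintro ⟨⟨h1, h2⟩, h3⟩
    exact ⟨⟨h1, by omega⟩, h3⟩
  · rintro ⟨⟨h1, h2⟩, h3⟩
    exact ⟨⟨h1, by omega⟩, h3⟩

lemma Lam_sum (m : ℕ) (w : ℤ → ℝ) :
    ∑ ℓ ∈ Lam m, w ℓ = ∑ i ∈ Finset.range m, if Int.gcd (1 + (i : ℤ)) m = 1 then w (1 + i) else 0 := by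
  rw [Finset.sum_filter, ← Finset.Ico_add_one_right_eq_Icc, Finset.sum_Ico_eq_sum_range]
  refine Finset.sum_congr (by simp) fun i _ => ?_
  have : Int.gcd (1 + (i : ℤ)) m = Nat.gcd (1 + i) m := by
    rw [← Int.gcd_natCast_natCast]; push_cast; rfl
  rw [this]; push_cast; rfl

lemma cop_sum (m : ℕ) (hm : 0 < m) (w : ℤ → ℝ) (hw : ∀ j, 0 ≤ w j) (hp : ∀ j, w (j + m) = w j)
    (a : ℤ) (N : ℕ) :
    ∑ ℓ ∈ Lam m, ∑ k ∈ Finset.range N, w (ℓ + (a + k)) ≤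
      (N * ((m.totient : ℝ) / m) + m.divisors.card) * ∑ i ∈ Finset.range m, w i := by
  rw [Finset.sum_comm]
  have h1 : ∀ k ∈ Finset.range N, ∑ ℓ ∈ Lam m, w (ℓ + (a + k)) =
      ∑ i ∈ Finset.range m, if Int.gcd ((i : ℤ) - (a + k)) m = 1 then w i else 0 := by
    intro k _
    rw [Lam_sum m (fun j => w (j + (a + k)))]
    have hper : ∀ j : ℤ, (fun j : ℤ => if Int.gcd (j - (a + k)) m = 1 then w j else 0) (j + m)
        = (fun j : ℤ => if Int.gcd (j - (a + k)) m = 1 then w j else 0) j := by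
      intro j
      simp only
      rw [hp, show j + (m : ℤ) - (a + k) = j - (a + k) + m by ring, Int.gcd_add_right_left_of_dvd]
      exact dvd_refl _
    have hsh := periodic_shift m (fun j : ℤ => if Int.gcd (j - (a + k)) m = 1 then w j else 0)
      hper (1 + (a + k))
    refine Eq.trans ?_ hsh
    refine Finset.sum_congr rfl fun i _ => ?_
    rw [show 1 + (a + (k : ℤ)) + i - (a + k) = 1 + i by ring,
      show (1 : ℤ) + i + (a + k) = 1 + (a + k) + i by ring]
  rw [Finset.sum_congr rfl h1, Finset.sum_comm, Finset.mul_sum]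
  refine Finset.sum_le_sum fun i _ => ?_
  rw [← Finset.sum_filter, Finset.sum_const, nsmul_eq_mul]
  refine mul_le_mul_of_nonneg_right ?_ (hw _)
  refine le_trans ?_ (sieve m hm ((i : ℤ) - a - N + 1) N)
  norm_cast
  refine Finset.card_le_card_of_injOn (fun k : ℕ => (i : ℤ) - (a + k)) ?_ ?_
  · intro k hk
    simp only [Finset.coe_filter, Finset.mem_range, Set.mem_ofPred_eq] at hk
    simp only [Finset.coe_filter, Finset.mem_Ico, Set.mem_ofPred_eq]
    refine ⟨⟨by omega, by omega⟩, hk.2⟩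
  · intro k _ k' _ h
    simp only at h
    omega

lemma cells (P : ℝ → ℝ) (hP : Continuous P) (hP0 : ∀ x, 0 ≤ P x) (hper : Function.Periodic P 1)
    (m : ℕ) (hm : 0 < m) (A B : ℝ) (hAB : A ≤ B) :
    ∑ ℓ ∈ Lam m, ∫ z in A..B, P ((ℓ : ℝ) / m + z) ≤
      ((m * (B - A) + 2) * ((m.totient : ℝ) / m) + m.divisors.card) * ∫ x in (0 : ℝ)..1, P x := by
  have hm' : (0 : ℝ) < m := by exact_mod_cast hm
  have hPi : ∀ a b, IntervalIntegrable P volume a b := fun a b => hP.intervalIntegrable a b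
  set w : ℤ → ℝ := fun j => ∫ x in ((j : ℝ) / m)..((j : ℝ) / m + 1 / m), P x with hw
  have hw0 : ∀ j, 0 ≤ w j := fun j => intervalIntegral.integral_nonneg
    (by have : 0 < 1 / (m : ℝ) := by positivity
        linarith) fun x _ => hP0 x
  have hwp : ∀ j, w (j + m) = w j := by
    intro j
    simp only [hw]
    have e1 : (((j + m : ℤ) : ℝ)) / m = (j : ℝ) / m + 1 := by push_cast; field_simp
    rw [e1, add_right_comm, ← intervalIntegral.integral_comp_add_right]
    simp only [hper _]
  have hwsum : ∑ i ∈ Finset.range m, w i = ∫ x in (0 : ℝ)..1, P x := by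
    have := intervalIntegral.sum_integral_adjacent_intervals (f := P) (μ := volume)
      (a := fun i : ℕ => (i : ℝ) / m) (n := m) (fun k _ => hPi _ _)
    simp only [Nat.cast_zero, zero_div, div_self hm'.ne'] at this
    rw [← this]
    refine Finset.sum_congr rfl fun i _ => ?_
    simp only [hw]
    congr 1
    push_cast; ring
  set a0 : ℤ := ⌊m * A⌋ with ha0
  have hmAB : m * A ≤ m * B := by gcongr
  have ha1 : (a0 : ℝ) ≤ m * A := Int.floor_le _
  have ha2 : m * A < a0 + 1 := Int.lt_floor_add_one _
  set N : ℕ := (⌈m * B⌉ - a0).toNat with hN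
  have hb1 : m * B ≤ ⌈m * B⌉ := Int.le_ceil _
  have hb2 : (⌈m * B⌉ : ℝ) < m * B + 1 := Int.ceil_lt_add_one _
  have hNint : (N : ℤ) = ⌈m * B⌉ - a0 := by
    rw [hN]; apply Int.toNat_of_nonneg
    have : (a0 : ℝ) ≤ ⌈m * B⌉ := by linarith
    have : a0 ≤ ⌈m * B⌉ := by exact_mod_cast this
    omega
  have hNr : (N : ℝ) = ⌈m * B⌉ - a0 := by exact_mod_cast hNint
  have hcell : ∀ ℓ ∈ Lam m, ∫ z in A..B, P ((ℓ : ℝ) / m + z) ≤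
      ∑ k ∈ Finset.range N, w ((ℓ : ℤ) + (a0 + k)) := by
    intro ℓ _
    have := intervalIntegral.sum_integral_adjacent_intervals (f := P) (μ := volume)
      (a := fun i : ℕ => ((ℓ : ℝ) + (a0 + i)) / m) (n := N) (fun k _ => hPi _ _)
    have e2 : ∑ k ∈ Finset.range N, w ((ℓ : ℤ) + (a0 + k)) =
        ∫ x in (((ℓ : ℝ) + (a0 + (0 : ℕ))) / m)..(((ℓ : ℝ) + (a0 + N)) / m), P x := by
      rw [← this]
      refine Finset.sum_congr rfl fun i _ => ?_
      simp only [hw]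
      push_cast
      congr 1
      ring
    rw [e2, intervalIntegral.integral_comp_add_left]
    apply intervalIntegral.integral_mono_interval
    · have : (ℓ : ℝ) / m + A = ((ℓ : ℝ) + m * A) / m := by field_simp
      rw [this]
      apply div_le_div_of_nonneg_right _ hm'.le
      push_cast; linarith
    · linarith
    · have : (ℓ : ℝ) / m + B = ((ℓ : ℝ) + m * B) / m := by field_simp
      rw [this]
      apply div_le_div_of_nonneg_right _ hm'.le
      linarith
    · exact Eventually.of_forall hP0
    · exact hPi _ _
  calc ∑ ℓ ∈ Lam m, ∫ z in A..B, P ((ℓ : ℝ) / m + z)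
      ≤ ∑ ℓ ∈ Lam m, ∑ k ∈ Finset.range N, w ((ℓ : ℤ) + (a0 + k)) := Finset.sum_le_sum hcell
    _ ≤ (N * ((m.totient : ℝ) / m) + m.divisors.card) * ∑ i ∈ Finset.range m, w i :=
        cop_sum m hm w hw0 hwp a0 N
    _ ≤ _ := by
        rw [hwsum]
        refine mul_le_mul_of_nonneg_right ?_ (intervalIntegral.integral_nonneg (by norm_num)
          fun x _ => hP0 x)
        gcongr
        rw [hNr]; linarith

/-- the sum over coprime residues -/
def Gs (f : XmodGamma → ℝ) (n m : ℕ) (t : ℝ) : ℝ :=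
  ∑ ℓ ∈ Lam m, hor f t ((ℓ : ℝ) / m + n * Real.exp (-t))

lemma subst_exp (P : ℝ → ℝ) (hP : Continuous P) (n c t0 ε : ℝ) :
    ∫ t in t0..(t0 + ε), P (c + n * Real.exp (-t)) * (n * Real.exp (-t))
        = ∫ z in (n * Real.exp (-(t0 + ε)))..(n * Real.exp (-t0)), P (c + z) := by
  have h1 : ∀ t ∈ Set.uIcc t0 (t0 + ε), HasDerivAt (fun t : ℝ => n * Real.exp (-t))
      (-(n * Real.exp (-t))) t := by
    intro t _
    have := ((Real.hasDerivAt_exp (-t)).comp t (hasDerivAt_neg t)).const_mul n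
    simpa [Function.comp_def] using this
  have h2 := intervalIntegral.integral_comp_mul_deriv (g := fun z => P (c + z)) h1
    (by fun_prop) (by fun_prop)
  rw [intervalIntegral.integral_symm (n * Real.exp (-t0)), ← h2, ← intervalIntegral.integral_neg]
  simp [Function.comp]

lemma window (f : XmodGamma → ℝ) (hf : Continuous f) (hf0 : ∀ x, 0 ≤ f x)
    (e ε : ℝ) (hε : 0 < ε)
    (hη : ∀ τ, 0 ≤ τ → τ ≤ ε → ∀ g, |f (pj (g * aSL τ)) - f (pj g)| ≤ e)
    (n m : ℕ) (hn : 0 < n) (hm : 0 < m) (t0 : ℝ) :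
    ∫ t in t0..(t0 + ε), Gs f n m t ≤ m.totient * (((Real.exp ε - 1) +
      Real.exp ε * (3 * (m.divisors.card : ℝ) ^ 2 * Real.exp t0 / (n * m))) * Hav f t0 + ε * e) := by
  have hm' : (0 : ℝ) < m := by exact_mod_cast hm
  have hn' : (0 : ℝ) < n := by exact_mod_cast hn
  obtain ⟨P, hPdef⟩ : ∃ P, P = hor f t0 := ⟨_, rfl⟩
  have hP : Continuous P := by rw [hPdef]; exact hor_cont hf t0
  have hP0 : ∀ x, 0 ≤ P x := fun x => by rw [hPdef]; exact hf0 _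
  have hPper : Function.Periodic P 1 := by rw [hPdef]; exact hor_per f t0
  have hPH : ∫ x in (0 : ℝ)..1, P x = Hav f t0 := by rw [hPdef]; rfl
  have hcont : ∀ c : ℝ, Continuous fun t : ℝ => hor f t (c + n * Real.exp (-t)) := by
    intro c
    refine hf.comp (pj_cont.comp ((uSL_cont.comp ?_).mul aSL_cont))
    fun_prop
  have hcP : ∀ c : ℝ, Continuous fun t : ℝ => P (c + n * Real.exp (-t)) * (n * Real.exp (-t)) := by
    intro c; fun_prop
  set Z := n * Real.exp (-t0) with hZ
  have hZ0 : 0 < Z := by positivity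
  set A := n * Real.exp (-(t0 + ε)) with hA
  have hAZ : A = Z * Real.exp (-ε) := by rw [hA, hZ, mul_assoc, ← Real.exp_add]; ring_nf
  have hA0 : 0 < A := by positivity
  have hexpε : Real.exp (-ε) ≤ 1 := Real.exp_le_one_iff.2 (by linarith)
  have hAZle : A ≤ Z := by rw [hAZ]; nlinarith
  have hone : ∀ c : ℝ, ∫ t in t0..(t0 + ε), hor f t (c + n * Real.exp (-t)) ≤
      1 / A * (∫ z in A..Z, P (c + z)) + ε * e := by
    intro c
    have hsub : ∫ t in t0..(t0 + ε), P (c + n * Real.exp (-t)) * (n * Real.exp (-t))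
        = ∫ z in A..Z, P (c + z) := by
      exact subst_exp P hP n c t0 ε
    calc ∫ t in t0..(t0 + ε), hor f t (c + n * Real.exp (-t))
        ≤ ∫ t in t0..(t0 + ε), (1 / A * (P (c + n * Real.exp (-t)) * (n * Real.exp (-t))) + e) := by
          refine intervalIntegral.integral_mono_on (by linarith) ((hcont c).intervalIntegrable _ _)
            ((((hcP c).const_mul _).add continuous_const).intervalIntegrable _ _) fun t ht => ?_
          have h3 := hη (t - t0) (by linarith [ht.1]) (by linarith [ht.2])
            (uSL (c + n * Real.exp (-t)) * aSL t0)
          rw [mul_assoc, ← aSL_add, add_sub_cancel] at h3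
          have h4 := (abs_le.1 h3).2
          have h5 : A ≤ n * Real.exp (-t) := by
            rw [hA]; gcongr; exact ht.2
          have h6 : P (c + n * Real.exp (-t)) ≤
              1 / A * (P (c + n * Real.exp (-t)) * (n * Real.exp (-t))) := by
            rw [one_div, ← div_eq_inv_mul, le_div_iff₀ hA0]
            exact mul_le_mul_of_nonneg_left h5 (hP0 _)
          simp only [hPdef, hor] at h6 ⊢
          linarith
      _ = _ := by
          rw [intervalIntegral.integral_add (((hcP c).const_mul _).intervalIntegrable _ _)
            (continuous_const.intervalIntegrable _ _), intervalIntegral.integral_const_mul, hsub]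
          simp
  have hH0 : 0 ≤ Hav f t0 := intervalIntegral.integral_nonneg (by norm_num) fun x _ => hf0 _
  have hφ0 : (0 : ℝ) < m.totient := by exact_mod_cast Nat.totient_pos.2 hm
  have hcells := cells P hP hP0 hPper m hm A Z hAZle
  rw [hPH] at hcells
  have hdm : (m : ℝ) ≤ m.divisors.card * m.totient := by
    exact_mod_cast le_totient_mul_divisors m
  have hd1 : (1 : ℝ) ≤ m.divisors.card := by
    exact_mod_cast Finset.card_pos.2 (Nat.nonempty_divisors.2 hm.ne')
  set d : ℝ := (m.divisors.card : ℝ) with hd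
  set φ : ℝ := (m.totient : ℝ) with hφ
  calc ∫ t in t0..(t0 + ε), Gs f n m t
      = ∑ ℓ ∈ Lam m, ∫ t in t0..(t0 + ε), hor f t ((ℓ : ℝ) / m + n * Real.exp (-t)) :=
        intervalIntegral.integral_finsetSum fun ℓ _ => (hcont _).intervalIntegrable _ _
    _ ≤ ∑ ℓ ∈ Lam m, (1 / A * (∫ z in A..Z, P ((ℓ : ℝ) / m + z)) + ε * e) :=
        Finset.sum_le_sum fun ℓ _ => hone _
    _ = 1 / A * (∑ ℓ ∈ Lam m, ∫ z in A..Z, P ((ℓ : ℝ) / m + z)) + φ * (ε * e) := by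
        rw [Finset.sum_add_distrib, ← Finset.mul_sum, Finset.sum_const, Lam_card, nsmul_eq_mul]
    _ ≤ 1 / A * (((m * (Z - A) + 2) * (φ / m) + d) * Hav f t0) + φ * (ε * e) := by
        gcongr
    _ ≤ 1 / A * ((φ * (Z - A) + φ * (3 * d ^ 2 / m)) * Hav f t0) + φ * (ε * e) := by
        refine add_le_add (mul_le_mul_of_nonneg_left (mul_le_mul_of_nonneg_right ?_ hH0)
          (by positivity)) le_rfl
        have h7 : (m * (Z - A) + 2) * (φ / m) = φ * (Z - A) + 2 * φ / m := by field_simp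
        have h8 : 2 * φ / m + d ≤ φ * (3 * d ^ 2 / m) := by
          rw [mul_div_assoc', div_add' _ _ _ hm'.ne']
          gcongr
          have : d * m ≤ d * (d * φ) := by gcongr
          have : φ * 1 ≤ φ * d ^ 2 := by gcongr; exact one_le_pow₀ hd1
          nlinarith
        linarith
    _ = _ := by
        have hA1 : 1 / A = Real.exp ε / Z := by
          rw [hAZ, Real.exp_neg]; field_simp
        have hZ1 : 1 / Z = Real.exp t0 / n := by
          rw [hZ, Real.exp_neg]; field_simp
        have e3 : 1 / A * (Z - A) = Real.exp ε - 1 := by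
          rw [mul_sub, hA1, ← hA1, one_div_mul_cancel hA0.ne', hA1]; field_simp
        have e4 : 1 / A * (3 * d ^ 2 / m) = Real.exp ε * (3 * d ^ 2 * Real.exp t0 / (n * m)) := by
          rw [hA1, div_eq_mul_one_div, hZ1]; field_simp
        rw [← e3, ← e4]; ring

lemma hor_line_cont {f : XmodGamma → ℝ} (hf : Continuous f) (n c : ℝ) :
    Continuous fun t : ℝ => hor f t (c + n * Real.exp (-t)) := by
  refine hf.comp (pj_cont.comp ((uSL_cont.comp ?_).mul aSL_cont))
  fun_prop

lemma Gs_cont {f : XmodGamma → ℝ} (hf : Continuous f) (n m : ℕ) : Continuous (Gs f n m) := by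
  unfold Gs
  exact continuous_finsetSum _ fun ℓ _ => hor_line_cont hf n _

lemma Gs_le {f : XmodGamma → ℝ} {C : ℝ} (hfC : ∀ x, f x ≤ C) (n m : ℕ) (t : ℝ) :
    Gs f n m t ≤ C * m.totient := by
  unfold Gs
  refine (Finset.sum_le_card_nsmul _ _ C fun ℓ _ => hfC _).trans ?_
  rw [Lam_card, nsmul_eq_mul, mul_comm]

lemma Gs_int_le {f : XmodGamma → ℝ} (hf : Continuous f) {C : ℝ} (hfC : ∀ x, f x ≤ C) (n m : ℕ)
    (a b : ℝ) (hab : a ≤ b) : ∫ t in a..b, Gs f n m t ≤ (b - a) * (C * m.totient) := by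
  have h := intervalIntegral.integral_mono_on (μ := volume) hab
    ((Gs_cont hf n m).intervalIntegrable a b)
    (continuous_const.intervalIntegrable a b : IntervalIntegrable (fun _ : ℝ => C * m.totient) volume a b)
    (fun t _ => Gs_le hfC n m t)
  rwa [intervalIntegral.integral_const, smul_eq_mul] at h

lemma core (f : XmodGamma → ℝ) (hf : Continuous f) (hf0 : ∀ x, 0 ≤ f x) (C : ℝ) (hC : 0 ≤ C)
    (hfC : ∀ x, f x ≤ C) (e ε e' H c ts : ℝ) (he : 0 ≤ e) (hε : 0 < ε) (he' : 0 ≤ e')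
    (hH0 : 0 ≤ H) (hc : 0 ≤ c) (hts : 0 ≤ ts)
    (hη : ∀ τ, 0 ≤ τ → τ ≤ ε → ∀ g, |f (pj (g * aSL τ)) - f (pj g)| ≤ e)
    (hexp : Real.exp ε - 1 ≤ ε * (1 + e'))
    (hH : ∀ t, ts ≤ t → Hav f t ≤ H)
    (n m : ℕ) (hn : 0 < n) (hm : 0 < m)
    (hd : 3 * Real.exp ε * ((m.divisors.card : ℝ) ^ 2 / (m : ℝ) ^ c) ≤ ε * e') :
    ∫ t in (0 : ℝ)..Real.log (n * m), Gs f n m t ≤ m.totient *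
      (Real.log (n * m) * ((1 + 2 * e') * H + e) + C * (ts + ε + c * Real.log m)) := by
  have hm' : (0 : ℝ) < m := by exact_mod_cast hm
  have hn' : (0 : ℝ) < n := by exact_mod_cast hn
  have hm1 : (1 : ℝ) ≤ m := by exact_mod_cast hm
  have hn1 : (1 : ℝ) ≤ n := by exact_mod_cast hn
  have hlm : 0 ≤ Real.log m := Real.log_nonneg hm1
  have hT0 : 0 ≤ Real.log (n * m) := Real.log_nonneg (by nlinarith)
  have hnm : Real.exp (Real.log (n * m)) = n * m := Real.exp_log (by positivity)
  set T := Real.log (n * m) with hT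
  have hφ0 : (0 : ℝ) < m.totient := by exact_mod_cast Nat.totient_pos.2 hm
  set φ : ℝ := (m.totient : ℝ) with hφ
  have hGi : ∀ a b, IntervalIntegrable (Gs f n m) volume a b :=
    fun a b => (Gs_cont hf n m).intervalIntegrable a b
  set W := (1 + 2 * e') * H + e with hW
  have hW0 : 0 ≤ W := by positivity
  by_cases hcase : T - c * Real.log m < ts
  · have h1 := Gs_int_le hf hfC n m 0 T hT0
    rw [sub_zero] at h1
    have h2 : T * C ≤ (ts + ε + c * Real.log m) * C :=
      mul_le_mul_of_nonneg_right (by linarith) hC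
    have h3 : φ * (T * C) ≤ φ * (T * W + C * (ts + ε + c * Real.log m)) := by
      apply mul_le_mul_of_nonneg_left _ hφ0.le
      have : 0 ≤ T * W := by positivity
      linarith
    linarith
  push Not at hcase
  -- each window
  have hwin : ∀ t0, ts ≤ t0 → t0 ≤ T - c * Real.log m →
      ∫ t in t0..(t0 + ε), Gs f n m t ≤ φ * (ε * W) := by
    intro t0 h1 h2
    refine (window f hf hf0 e ε hε hη n m hn hm t0).trans ?_
    have h3 : Real.exp t0 / (n * m) ≤ 1 / (m : ℝ) ^ c := by
      rw [Real.rpow_def_of_pos hm', ← hnm, ← Real.exp_sub, one_div, ← Real.exp_neg]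
      apply Real.exp_le_exp.2
      linarith
    have h4 : Real.exp ε * (3 * (m.divisors.card : ℝ) ^ 2 * Real.exp t0 / (n * m)) ≤ ε * e' := by
      refine le_trans ?_ hd
      calc Real.exp ε * (3 * (m.divisors.card : ℝ) ^ 2 * Real.exp t0 / (n * m))
          = 3 * Real.exp ε * (m.divisors.card : ℝ) ^ 2 * (Real.exp t0 / (n * m)) := by ring
        _ ≤ 3 * Real.exp ε * (m.divisors.card : ℝ) ^ 2 * (1 / (m : ℝ) ^ c) := by gcongr
        _ = _ := by ring
    apply mul_le_mul_of_nonneg_left _ hφ0.le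
    have h5 : 0 ≤ Hav f t0 := intervalIntegral.integral_nonneg (by norm_num) fun x _ => hf0 _
    have h6 := mul_le_mul (add_le_add hexp h4) (hH t0 h1) h5 (by positivity)
    refine (add_le_add_left h6 (ε * e)).trans (le_of_eq ?_)
    rw [hW]; ring
  set K := ⌊(T - c * Real.log m - ts) / ε⌋₊ with hK
  have hK1 : (K : ℝ) * ε ≤ T - c * Real.log m - ts := by
    have := Nat.floor_le (a := (T - c * Real.log m - ts) / ε) (div_nonneg (by linarith) hε.le)
    rwa [le_div_iff₀ hε] at this
  have hK2 : T - c * Real.log m - ts < (K + 1) * ε := by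
    have := Nat.lt_floor_add_one ((T - c * Real.log m - ts) / ε)
    rwa [div_lt_iff₀ hε] at this
  have hmid : ∫ t in ts..(ts + K * ε), Gs f n m t ≤ K * (φ * (ε * W)) := by
    have h := intervalIntegral.sum_integral_adjacent_intervals (f := Gs f n m) (μ := volume)
      (a := fun k : ℕ => ts + k * ε) (n := K) (fun k _ => hGi _ _)
    simp only [Nat.cast_zero, zero_mul, add_zero] at h
    rw [← h]
    refine (Finset.sum_le_card_nsmul _ _ (φ * (ε * W)) fun k hk => ?_).trans ?_
    · have hk' : (k : ℝ) + 1 ≤ K := by exact_mod_cast Finset.mem_range.1 hk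
      have := hwin (ts + k * ε) (by have : 0 ≤ (k : ℝ) * ε := by positivity
                                    linarith) (by nlinarith)
      have e1 : ts + ((k + 1 : ℕ) : ℝ) * ε = ts + k * ε + ε := by push_cast; ring
      rw [e1]; exact this
    · rw [Finset.card_range, nsmul_eq_mul]
  have hclm : 0 ≤ c * Real.log m := by positivity
  have h1 := Gs_int_le hf hfC n m 0 ts hts
  have h2 := Gs_int_le hf hfC n m (ts + K * ε) T (by linarith)
  rw [← intervalIntegral.integral_add_adjacent_intervals (hGi 0 ts) (hGi ts T),
    ← intervalIntegral.integral_add_adjacent_intervals (hGi ts (ts + K * ε)) (hGi _ T)]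
  have h3 : (T - (ts + K * ε)) * (C * φ) ≤ (ε + c * Real.log m) * (C * φ) :=
    mul_le_mul_of_nonneg_right (by linarith) (by positivity)
  have h4 : (K * ε) * (φ * W) ≤ T * (φ * W) :=
    mul_le_mul_of_nonneg_right (by linarith) (by positivity)
  rw [← hφ] at h1 h2
  linarith

lemma exists_eps {f : XmodGamma → ℝ} (hruc : RUC f) (e e' : ℝ) (he : 0 < e) (he' : 0 < e') :
    ∃ ε > 0, (∀ τ, 0 ≤ τ → τ ≤ ε → ∀ g, |f (pj (g * aSL τ)) - f (pj g)| ≤ e) ∧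
      Real.exp ε - 1 ≤ ε * (1 + e') := by
  obtain ⟨δ, hδ, h⟩ := hruc e he
  set ε := min 1 (min e' (δ / 2)) with hε
  have h0 : 0 < ε := by positivity
  have h1 : ε ≤ 1 := min_le_left _ _
  have h2 : ε ≤ e' := (min_le_right _ _).trans (min_le_left _ _)
  have h3 : ε ≤ δ / 2 := (min_le_right _ _).trans (min_le_right _ _)
  refine ⟨ε, h0, fun τ t0 t1 g => h _ ?_ g, ?_⟩
  · have hx : ∀ x : ℝ, |x| ≤ τ / 2 → |Real.exp x - 1| < δ := by
      intro x hx
      have := Real.abs_exp_sub_one_le (x := x) (by linarith)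
      linarith
    have ha : |τ / 2| ≤ τ / 2 := by rw [abs_of_nonneg (by linarith)]
    refine ⟨?_, ?_, ?_, ?_⟩
    · have := hx (-(τ / 2)) (by rwa [abs_neg])
      simpa using this
    · simpa using hδ
    · simpa using hδ
    · simpa using hx _ ha
  · have := Real.abs_exp_sub_one_sub_id_le (x := ε) (by rwa [abs_of_pos h0])
    have := (abs_le.1 this).2
    nlinarith

lemma avg_upper (μ : Measure XmodGamma) [IsProbabilityMeasure μ]
    (hμ : ∀ h : SL2R, Measure.map (rmul h) μ = μ)
    (n m : ℕ → ℕ) (hn : ∀ i, 0 < n i) (hm : ∀ i, 0 < m i)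
    (hm' : Tendsto m atTop atTop)
    (f : XmodGamma → ℝ) (hf : Continuous f) (hf0 : ∀ x, 0 ≤ f x) (C : ℝ) (hC : 0 < C)
    (hfC : ∀ x, f x ≤ C) (hruc : RUC f) (e : ℝ) (he : 0 < e) :
    ∀ᶠ i in atTop, (1 / (Real.log ((n i : ℝ) * (m i : ℝ)) * (Nat.totient (m i) : ℝ))) *
      ∫ t in (0 : ℝ)..Real.log ((n i : ℝ) * (m i : ℝ)), Gs f (n i) (m i) t ≤
        ∫ x, f x ∂μ + e := by
  have hM0 : 0 ≤ ∫ x, f x ∂μ := integral_nonneg hf0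
  set M := ∫ x, f x ∂μ with hM
  set e1 := min 1 (e / 8) with he1
  have he1p : 0 < e1 := by positivity
  have he1a : e1 ≤ 1 := min_le_left _ _
  have he1b : e1 ≤ e / 8 := min_le_right _ _
  set e' := e / (16 * (M + 1)) with he'
  have he'p : 0 < e' := by positivity
  have he'M : 2 * e' * (M + 1) = e / 8 := by rw [he']; field_simp; norm_num
  obtain ⟨ε, hε, hη, hexp⟩ := exists_eps hruc e1 e' he1p he'p
  obtain ⟨ts0, hts0⟩ := eventually_atTop.1 (horo_upper μ hμ f hf hf0 C hfC hruc e1 he1p)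
  set ts := max 0 ts0
  have hts : 0 ≤ ts := le_max_left _ _
  have hH : ∀ t, ts ≤ t → Hav f t ≤ M + e1 := fun t ht => hts0 t ((le_max_right _ _).trans ht)
  set c := e / (8 * C) with hc
  have hcp : 0 < c := by positivity
  have hcC : C * c = e / 8 := by rw [hc]; field_simp
  have hdiv : ∀ᶠ i in atTop, 3 * Real.exp ε * (((m i).divisors.card : ℝ) ^ 2 / ((m i : ℕ) : ℝ) ^ c)
      ≤ ε * e' := by
    have h := ((divisor_sq_tendsto c hcp).comp hm').const_mul (3 * Real.exp ε)
    rw [mul_zero] at h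
    exact h.eventually (eventually_le_nhds (by positivity))
  have hlog : ∀ᶠ i in atTop, max 1 (C * (ts + ε) / (e / 8)) ≤ Real.log ((m i : ℕ) : ℝ) :=
    (Real.tendsto_log_atTop.comp (tendsto_natCast_atTop_atTop.comp hm')).eventually
      (eventually_ge_atTop _)
  filter_upwards [hdiv, hlog] with i hdi hlo
  have hmi : (1 : ℝ) ≤ m i := by exact_mod_cast hm i
  have hni : (1 : ℝ) ≤ n i := by exact_mod_cast hn i
  have hlT : Real.log (m i) ≤ Real.log (n i * m i) := Real.log_le_log (by linarith) (by nlinarith)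
  have hcore := core f hf hf0 C hC.le hfC e1 ε e' (M + e1) c ts he1p.le hε he'p.le (by positivity)
    hcp.le hts hη hexp hH (n i) (m i) (hn i) (hm i) hdi
  have hφ0 : (0 : ℝ) < (m i).totient := by exact_mod_cast Nat.totient_pos.2 (hm i)
  set T := Real.log (n i * m i) with hT
  have hT1 : 1 ≤ T := (le_max_left _ _).trans (hlo.trans hlT)
  have hT2 : C * (ts + ε) / (e / 8) ≤ T := (le_max_right _ _).trans (hlo.trans hlT)
  rw [div_le_iff₀ (by positivity)] at hT2
  rw [one_div, ← div_eq_inv_mul, div_le_iff₀ (by positivity)]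
  refine hcore.trans ?_
  rw [show (M + e) * (T * ((m i).totient : ℝ)) = (m i).totient * (T * (M + e)) by ring]
  apply mul_le_mul_of_nonneg_left _ hφ0.le
  have h1 : C * (c * Real.log (m i)) ≤ e / 8 * T := by
    rw [← mul_assoc, hcC]; gcongr
  have h2 : (1 + 2 * e') * (M + e1) + e1 ≤ M + 3 * (e / 8) := by
    have : 2 * e' * (M + e1) ≤ 2 * e' * (M + 1) := by gcongr
    linarith
  have h3 : T * ((1 + 2 * e') * (M + e1) + e1) ≤ T * (M + 3 * (e / 8)) :=
    mul_le_mul_of_nonneg_left h2 (by linarith)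
  nlinarith

lemma ruc_const_add {f : XmodGamma → ℝ} (h : RUC f) (C : ℝ) : RUC fun x => C + f x := by
  intro e he
  obtain ⟨δ, h0, h1⟩ := h e he
  refine ⟨δ, h0, fun k hk g => ?_⟩
  rw [add_sub_add_left_eq_sub]; exact h1 k hk g

lemma Gs_add (f : XmodGamma → ℝ) (C : ℝ) (n m : ℕ) (t : ℝ) :
    Gs (fun x => C + f x) n m t = C * m.totient + Gs f n m t := by
  simp only [Gs, hor]
  rw [Finset.sum_add_distrib, Finset.sum_const, Lam_card, nsmul_eq_mul, mul_comm]

lemma Gs_sub (f : XmodGamma → ℝ) (C : ℝ) (n m : ℕ) (t : ℝ) :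
    Gs (fun x => C - f x) n m t = C * m.totient - Gs f n m t := by
  simp only [Gs, hor]
  rw [Finset.sum_sub_distrib, Finset.sum_const, Lam_card, nsmul_eq_mul, mul_comm]

/-- If `μ` is a right-`SL₂(ℝ)`-invariant Borel probability measure on
`X = SL₂(ℤ)\SL₂(ℝ)`, `n_i, m_i → ∞` and `T_i = ln(n_i·m_i)`, then the averages
of `f` over the translated pieces of diagonal orbits through the points
`Γ·(u_{ℓ/m_i}·a(t)·u_{n_i})`, `ℓ ∈ Λ_{m_i}`, `t ∈ [0,T_i]`, converge to `∫ f dμ`. -/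
theorem stmt16 (μ : Measure XmodGamma) [IsProbabilityMeasure μ]
    (hμinv : ∀ h : SL2R, Measure.map (rmul h) μ = μ)
    (n m : ℕ → ℕ) (hn : ∀ i, 0 < n i) (hm : ∀ i, 0 < m i)
    (hn' : Tendsto n atTop atTop) (hm' : Tendsto m atTop atTop)
    (f : XmodGamma → ℝ) (hf : Continuous f) (hfc : HasCompactSupport f) :
    Tendsto (fun i =>
        (1 / (Real.log ((n i : ℝ) * (m i : ℝ)) * (Nat.totient (m i) : ℝ))) *
          ∑ ℓ ∈ (Finset.Icc 1 (m i)).filter (fun ℓ => Nat.gcd ℓ (m i) = 1),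
            ∫ t in (0 : ℝ)..(Real.log ((n i : ℝ) * (m i : ℝ))),
              f (Quotient.mk'' (uSL ((ℓ : ℝ) / (m i : ℝ)) * aSL t * uSL (n i : ℝ))))
      atTop (nhds (∫ x, f x ∂μ)) := by
  have hsum : ∀ i, ∑ ℓ ∈ (Finset.Icc 1 (m i)).filter (fun ℓ => Nat.gcd ℓ (m i) = 1),
            ∫ t in (0 : ℝ)..(Real.log ((n i : ℝ) * (m i : ℝ))),
              f (Quotient.mk'' (uSL ((ℓ : ℝ) / (m i : ℝ)) * aSL t * uSL (n i : ℝ)))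
      = ∫ t in (0 : ℝ)..(Real.log ((n i : ℝ) * (m i : ℝ))), Gs f (n i) (m i) t := by
    intro i
    unfold Gs
    rw [intervalIntegral.integral_finsetSum fun ℓ _ =>
      (hor_line_cont hf (n i) _).intervalIntegrable _ _]
    refine Finset.sum_congr rfl fun ℓ _ => ?_
    refine intervalIntegral.integral_congr fun t _ => ?_
    simp only [uSL_aSL_uSL]
    rfl
  simp only [hsum]
  obtain ⟨C0, hC0⟩ := hf.bounded_above_of_compact_support hfc
  set C := max C0 1 with hCdef
  have hC : 0 < C := lt_of_lt_of_le one_pos (le_max_right _ _)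
  have hfC : ∀ x, |f x| ≤ C := fun x => (hC0 x).trans (le_max_left _ _)
  have hruc := ruc_of_compact f hf hfc
  have hfi : Integrable f μ := Integrable.of_bound hf.measurable.aestronglyMeasurable C
    (Eventually.of_forall hfC)
  rw [Metric.tendsto_atTop']
  have hlog : ∀ᶠ i in atTop, 1 ≤ Real.log ((m i : ℕ) : ℝ) :=
    (Real.tendsto_log_atTop.comp (tendsto_natCast_atTop_atTop.comp hm')).eventually
      (eventually_ge_atTop _)
  intro e he
  have hA := avg_upper μ hμinv n m hn hm hm' (fun x => C + f x) (continuous_const.add hf)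
    (fun x => by linarith [(abs_le.1 (hfC x)).1]) (2 * C) (by positivity)
    (fun x => by linarith [(abs_le.1 (hfC x)).2]) (ruc_const_add hruc C) (e / 2) (by positivity)
  have hB := avg_upper μ hμinv n m hn hm hm' (fun x => C - f x) (continuous_const.sub hf)
    (fun x => by linarith [(abs_le.1 (hfC x)).2]) (2 * C) (by positivity)
    (fun x => by linarith [(abs_le.1 (hfC x)).1]) (ruc_const_sub hruc C) (e / 2) (by positivity)
  rw [integral_add (integrable_const C) hfi] at hA
  rw [integral_sub (integrable_const C) hfi] at hB
  simp only [integral_const, probReal_univ, one_smul] at hA hB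
  obtain ⟨N, hN⟩ := eventually_atTop.1 ((hA.and hB).and hlog)
  refine ⟨N, fun i hi => ?_⟩
  obtain ⟨⟨h1, h2⟩, h3⟩ := hN i hi.le
  have hmi : (1 : ℝ) ≤ m i := by exact_mod_cast hm i
  have hni : (1 : ℝ) ≤ n i := by exact_mod_cast hn i
  have hlT : Real.log (m i) ≤ Real.log (n i * m i) := Real.log_le_log (by linarith) (by nlinarith)
  have hφ0 : (0 : ℝ) < (m i).totient := by exact_mod_cast Nat.totient_pos.2 (hm i)
  have hT : 0 < Real.log (n i * m i) := by linarith
  have hGi : IntervalIntegrable (Gs f (n i) (m i)) volume 0 (Real.log (n i * m i)) :=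
    (Gs_cont hf _ _).intervalIntegrable _ _
  have hci : IntervalIntegrable (fun _ : ℝ => C * ((m i).totient : ℝ)) volume 0
    (Real.log (n i * m i)) := continuous_const.intervalIntegrable _ _
  simp only [Gs_add] at h1
  simp only [Gs_sub] at h2
  rw [intervalIntegral.integral_add hci hGi, mul_add, intervalIntegral.integral_const] at h1
  rw [intervalIntegral.integral_sub hci hGi, mul_sub, intervalIntegral.integral_const] at h2
  have hcc : 1 / (Real.log (n i * m i) * ((m i).totient : ℝ)) *
      ((Real.log (n i * m i) - 0) • (C * ((m i).totient : ℝ))) = C := by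
    rw [smul_eq_mul, sub_zero]; field_simp
  rw [hcc] at h1 h2
  rw [Real.dist_eq, abs_lt]
  constructor <;> linarith

end
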